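/- Let N be a norm on ℝ² whose restriction to ℝ² \ {0} is of class C^{2,δ} for some δ ∈ (0,1), and assume the N-unit circle has strictly positive Euclidean curvature at every point. Then for every Borel set A ⊆ ℝ² with s := dim A > 1, the exceptional set satisfies dim {v ∈ S¹ : ℋ¹(P_v(A)) = 0} ≤ 2 − min{s, 1 + δ}. -/

import Mathlib

open Set Metric MeasureTheory
open scoped ENNReal RealInnerProductSpace

noncomputable section

namespace DyadicContent

open Filter Topology

variable {X ι : Type*}

/-- A family `F` of cells `(n, k)` covers `A` when every point of `A` has a cell in `F`. -/
def Covers (cell : ℕ → X → ι) (F : Set (ℕ × ι)) (A : Set X) : Prop :=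
  ∀ x ∈ A, ∃ n, (n, cell n x) ∈ F

/-- The total weight of a family of cells, a cell of level `n` having weight `a n`. -/
def weight (a : ℕ → ℝ≥0∞) (F : Set (ℕ × ι)) : ℝ≥0∞ :=
  ∑' q, F.indicator (fun q => a q.1) q

/-- The infimum of the weights of the families of cells covering `A`. -/
def content (cell : ℕ → X → ι) (a : ℕ → ℝ≥0∞) (A : Set X) : ℝ≥0∞ :=
  ⨅ (F : Set (ℕ × ι)) (_ : Covers cell F A), weight a F

/-- The cells of `F` that are not contained in a cell of `F` of smaller level. -/
def maximalCells (cell : ℕ → X → ι) (F : Set (ℕ × ι)) : Set (ℕ × ι) :=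
  {q | q ∈ F ∧ ∀ x, cell q.1 x = q.2 → ∀ m < q.1, (m, cell m x) ∉ F}

variable {cell : ℕ → X → ι} {a : ℕ → ℝ≥0∞}

lemma content_le {F : Set (ℕ × ι)} {A : Set X} (h : Covers cell F A) :
    content cell a A ≤ weight a F :=
  iInf₂_le F h

lemma content_mono {A B : Set X} (h : A ⊆ B) : content cell a A ≤ content cell a B :=
  le_iInf₂ fun _ hF => content_le fun x hx => hF x (h hx)

lemma exists_covers_weight_le {A : Set X} (h : content cell a A ≠ ∞) {ε : ℝ≥0∞} (hε : ε ≠ 0) :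
    ∃ F : Set (ℕ × ι), Covers cell F A ∧ weight a F ≤ content cell a A + ε := by
  have := ENNReal.lt_add_right h hε
  conv_lhs at this => rw [content]
  simp only [iInf_lt_iff] at this
  obtain ⟨F, hF, h⟩ := this
  exact ⟨F, hF, h.le⟩

lemma exists_minimal_nat {p : ℕ → Prop} (h : ∃ k, p k) : ∃ k, p k ∧ ∀ m < k, ¬ p m := by
  classical
  exact ⟨Nat.find h, Nat.find_spec h, fun m hm => Nat.find_min h hm⟩

lemma cell_eq_of_le (hcell : ∀ n x y, cell (n + 1) x = cell (n + 1) y → cell n x = cell n y)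
    {m n : ℕ} (hmn : m ≤ n) {x y : X} (h : cell n x = cell n y) : cell m x = cell m y := by
  induction n, hmn using Nat.le_induction with
  | base => exact h
  | succ n _ ih => exact ih (hcell n x y h)

/-- The cell of least level of `F` containing `x` is maximal. -/
lemma mem_maximalCells (hcell : ∀ n x y, cell (n + 1) x = cell (n + 1) y → cell n x = cell n y)
    {F : Set (ℕ × ι)} {x : X} {n : ℕ} (hn : (n, cell n x) ∈ F)
    (hmin : ∀ m < n, (m, cell m x) ∉ F) : (n, cell n x) ∈ maximalCells cell F := by
  refine ⟨hn, fun y hy m hm => ?_⟩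
  rw [cell_eq_of_le hcell (le_of_lt hm) hy]
  exact hmin m hm

lemma weight_maximalCells_union_add_le
    {F G : Set (ℕ × ι)} {A : Set X} (hF : Covers cell F A) (hG : Covers cell G A) :
    weight a (maximalCells cell (F ∪ G)) + content cell a A ≤ weight a F + weight a G := by
  classical
  set T := maximalCells cell (F ∪ G) with hT
  have hTsub : T ⊆ F ∪ G := fun q hq => hq.1
  have hR : Covers cell ((F ∩ G) ∪ ((F ∪ G) \ T)) A := by
    intro x hx
    obtain ⟨n, hn⟩ := hF x hx
    obtain ⟨m, hm⟩ := hG x hx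
    rcases lt_trichotomy n m with h | h | h
    · exact ⟨m, Or.inr ⟨Or.inr hm, fun hmT => hmT.2 x rfl n h (Or.inl hn)⟩⟩
    · subst h
      exact ⟨n, Or.inl ⟨hn, hm⟩⟩
    · exact ⟨n, Or.inr ⟨Or.inl hn, fun hmT => hmT.2 x rfl m h (Or.inr hm)⟩⟩
  refine (add_le_add le_rfl (content_le hR)).trans ?_
  simp only [weight]
  rw [← ENNReal.tsum_add, ← ENNReal.tsum_add]
  refine ENNReal.tsum_le_tsum fun q => ?_
  have := @hTsub q
  by_cases h1 : q ∈ F <;> by_cases h2 : q ∈ G <;> by_cases h3 : q ∈ T <;>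
    simp_all [indicator]

/-- The content is continuous along increasing sequences of sets. -/
theorem content_iUnion_le
    (hcell : ∀ n x y, cell (n + 1) x = cell (n + 1) y → cell n x = cell n y)
    {A : ℕ → Set X} (hA : Monotone A) :
    content cell a (⋃ n, A n) ≤ ⨆ n, content cell a (A n) := by
  by_cases htop : (⨆ n, content cell a (A n)) = ∞
  · rw [htop]; exact le_top
  have hfin : ∀ n, content cell a (A n) ≠ ∞ := fun n =>
    ne_top_of_le_ne_top htop (le_iSup (fun n => content cell a (A n)) n)
  refine ENNReal.le_of_forall_pos_le_add fun ε hε _ => ?_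
  obtain ⟨e, he0, heε⟩ := ENNReal.exists_pos_sum_of_countable' (ENNReal.coe_pos.2 hε).ne' ℕ
  choose Q hQ hQw using fun n => exists_covers_weight_le (hfin n) (he0 n).ne'
  let W : ℕ → Set (ℕ × ι) := fun n =>
    Nat.rec (Q 0) (fun k F => maximalCells cell (F ∪ Q (k + 1))) n
  have hW : ∀ n, W (n + 1) = maximalCells cell (W n ∪ Q (n + 1)) := fun n => rfl
  have hWcov : ∀ n, Covers cell (W n) (A n) := by
    intro n
    cases n with
    | zero => exact hQ 0
    | succ n =>
      intro x hx
      have hex : ∃ k, (k, cell k x) ∈ W n ∪ Q (n + 1) := by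
        obtain ⟨k, hk⟩ := hQ (n + 1) x hx
        exact ⟨k, Or.inr hk⟩
      obtain ⟨k, hk, hmin⟩ : ∃ k, (k, cell k x) ∈ W n ∪ Q (n + 1) ∧
          ∀ m < k, (m, cell m x) ∉ W n ∪ Q (n + 1) :=
        exists_minimal_nat hex
      refine ⟨k, ?_⟩
      rw [hW]
      exact mem_maximalCells hcell hk hmin
  have hWw : ∀ n, weight a (W n) ≤ content cell a (A n) + ∑ i ∈ Finset.range (n + 1), e i := by
    intro n
    induction n with
    | zero => simpa [W] using hQw 0
    | succ n ih =>
      have h1 : Covers cell (Q (n + 1)) (A n) := fun x hx => hQ (n + 1) x (hA n.le_succ hx)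
      have h2 := weight_maximalCells_union_add_le (a := a) (hWcov n) h1
      rw [← hW] at h2
      refine (ENNReal.add_le_add_iff_right (hfin n)).1 (h2.trans ?_)
      refine (add_le_add ih (hQw (n + 1))).trans (le_of_eq ?_)
      rw [Finset.sum_range_succ _ (n + 1)]
      ring
  have hcov : Covers cell {q | ∀ᶠ n in atTop, q ∈ W n} (⋃ n, A n) := by
    intro x hx
    obtain ⟨m, hm⟩ := mem_iUnion.1 hx
    have hex : ∀ n, ∃ k, (k, cell k x) ∈ W (m + n) ∧
        ∀ j < k, (j, cell j x) ∉ W (m + n) := fun n =>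
      exists_minimal_nat (hWcov (m + n) x (hA (Nat.le_add_right m n) hm))
    choose l hlW hlmin using hex
    have hl : Antitone l := by
      refine antitone_nat_of_succ_le fun n => ?_
      obtain ⟨k, hk, hkmin⟩ := exists_minimal_nat
        (p := fun k => (k, cell k x) ∈ W (m + n) ∪ Q (m + n + 1)) ⟨l n, Or.inl (hlW n)⟩
      have h1 : (k, cell k x) ∈ W (m + (n + 1)) := by
        rw [← add_assoc, hW]
        exact mem_maximalCells hcell hk hkmin
      exact (not_lt.1 fun h => hlmin (n + 1) k h h1).trans
        (not_lt.1 fun h => hkmin (l n) h (Or.inl (hlW n)))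
    obtain ⟨N, hN⟩ := WellFoundedLT.antitone_chain_condition hl
    refine ⟨l N, ?_⟩
    rw [mem_ofPred_eq, eventually_atTop]
    refine ⟨m + N, fun n hn => ?_⟩
    obtain ⟨k, rfl⟩ := Nat.exists_eq_add_of_le hn
    have h1 : l N = l (N + k) := hN (N + k) (Nat.le_add_right _ _)
    rw [h1, add_assoc]
    exact hlW (N + k)
  refine (content_le hcov).trans ?_
  rw [weight, ENNReal.tsum_eq_iSup_sum]
  refine iSup_le fun s => ?_
  have hev : ∀ᶠ n in atTop, ∀ q ∈ s, (∀ᶠ n in atTop, q ∈ W n) → q ∈ W n := by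
    rw [Filter.eventually_all_finset]
    intro q _
    by_cases h : ∀ᶠ n in atTop, q ∈ W n
    · filter_upwards [h] with n hn _ using hn
    · exact Eventually.of_forall fun n h' => absurd h' h
  obtain ⟨n, hn⟩ := hev.exists
  calc ∑ q ∈ s, {q | ∀ᶠ n in atTop, q ∈ W n}.indicator (fun q => a q.1) q
      ≤ ∑ q ∈ s, (W n).indicator (fun q => a q.1) q := by
        refine Finset.sum_le_sum fun q hq => ?_
        by_cases h : ∀ᶠ n in atTop, q ∈ W n
        · rw [indicator_of_mem (hn q hq h)]
          exact indicator_le_self _ _ _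
        · rw [indicator_of_notMem (by simpa using h)]
          exact zero_le
    _ ≤ weight a (W n) := ENNReal.sum_le_tsum s
    _ ≤ content cell a (A n) + ∑ i ∈ Finset.range (n + 1), e i := hWw n
    _ ≤ _ := add_le_add (le_iSup (fun n => content cell a (A n)) n)
        ((ENNReal.sum_le_tsum _).trans heε.le)

end DyadicContent

open Filter Topology in
/-- Capacitability of analytic sets, for a set function that is monotone and continuous along
increasing sequences: some compact subset has all its neighbourhoods of large capacity. -/
theorem MeasureTheory.AnalyticSet.exists_isCompact_forall_isOpen_lt {X : Type*}
    [TopologicalSpace X] {A : Set X} (hA : AnalyticSet A) {c : Set X → ℝ≥0∞} (hc : Monotone c)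
    (hiUnion : ∀ B : ℕ → Set X, Monotone B → c (⋃ n, B n) ≤ ⨆ n, c (B n))
    {a : ℝ≥0∞} (ha : a < c A) :
    ∃ K ⊆ A, IsCompact K ∧ ∀ U, IsOpen U → K ⊆ U → a < c U := by
  rw [AnalyticSet] at hA
  rcases hA with rfl | ⟨f, hf, rfl⟩
  · exact ⟨∅, Subset.rfl, isCompact_empty, fun U _ _ => ha.trans_le (hc (empty_subset U))⟩
  have key : ∀ (S : Set (ℕ → ℕ)) (k : ℕ), a < c (f '' S) →
      ∃ m, a < c (f '' (S ∩ {σ | σ k ≤ m})) := by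
    intro S k hS
    have hmono : Monotone fun m : ℕ => f '' (S ∩ {σ | σ k ≤ m}) := fun m m' h =>
      image_mono (inter_subset_inter_right S fun σ (hσ : σ k ≤ m) => hσ.trans h)
    have hU : f '' S ⊆ ⋃ m : ℕ, f '' (S ∩ {σ | σ k ≤ m}) := by
      rintro _ ⟨σ, hσ, rfl⟩
      exact mem_iUnion.2 ⟨σ k, σ, ⟨hσ, le_refl (σ k)⟩, rfl⟩
    exact lt_iSup_iff.1 ((hS.trans_le (hc hU)).trans_le (hiUnion _ hmono))
  choose! m hm using key
  let S : ℕ → Set (ℕ → ℕ) := fun n => Nat.rec univ (fun k S => S ∩ {σ | σ k ≤ m S k}) n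
  have hS : ∀ n, a < c (f '' S n) := by
    intro n
    induction n with
    | zero => simpa [S] using ha
    | succ n ih => exact hm (S n) n ih
  let b : ℕ → ℕ := fun k => m (S k) k
  have hSb : ∀ n, S n = {σ | ∀ i < n, σ i ≤ b i} := by
    intro n
    induction n with
    | zero => simp [S]
    | succ n ih =>
      have : S (n + 1) = S n ∩ {σ | σ n ≤ b n} := rfl
      rw [this, ih]
      ext σ
      simp only [mem_inter_iff, mem_ofPred_eq, Nat.lt_succ_iff_lt_or_eq]
      exact ⟨fun h i hi => hi.elim (h.1 i) (fun e => e ▸ h.2),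
        fun h => ⟨fun i hi => h i (Or.inl hi), h n (Or.inr rfl)⟩⟩
  have hB : IsCompact (pi univ fun i => Iic (b i)) :=
    isCompact_univ_pi fun i => (finite_Iic (b i)).isCompact
  refine ⟨f '' pi univ fun i => Iic (b i), image_subset_range _ _, hB.image hf, fun U hU hKU => ?_⟩
  obtain ⟨n, hn⟩ : ∃ n, S n ⊆ f ⁻¹' U := by
    by_contra! h
    have h' : ∀ n, ∃ σ ∈ S n, f σ ∉ U := fun n => not_subset.1 (h n)
    choose σ hσS hσU using h'
    let τ : ℕ → ℕ → ℕ := fun n i => min (σ n i) (b i)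
    obtain ⟨ρ, hρ, φ, hφ, hlim⟩ := hB.tendsto_subseq (x := τ) fun n i _ =>
      mem_Iic.2 (min_le_right (σ n i) (b i))
    have hlim' : Tendsto (σ ∘ φ) atTop (𝓝 ρ) := by
      rw [tendsto_pi_nhds] at hlim ⊢
      intro i
      refine (hlim i).congr' ?_
      filter_upwards [eventually_gt_atTop i] with n hn
      have := hσS (φ n)
      rw [hSb] at this
      exact min_eq_left (this i (hn.trans_le (hφ.id_le n)))
    have hmem : ∀ᶠ n in atTop, (σ ∘ φ) n ∈ f ⁻¹' U :=
      hlim'.eventually_mem ((hU.preimage hf).mem_nhds (hKU ⟨ρ, hρ, rfl⟩))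
    obtain ⟨n, hn⟩ := hmem.exists
    exact hσU _ hn
  exact (hS n).trans_le (hc (image_subset_iff.2 hn))

namespace DyadicContent

open Filter Topology
open scoped NNReal

variable {X ι : Type*} {cell : ℕ → X → ι} {a : ℕ → ℝ≥0∞}

/-- A fractional cover by cells is at least as expensive as the best genuine cover. -/
theorem content_le_of_one_le_sum [Countable ι]
    (hcell : ∀ n x y, cell (n + 1) x = cell (n + 1) y → cell n x = cell n y)
    (c : ℕ × ι → ℝ≥0) {A : Set X}
    (hc : ∀ x ∈ A, ∃ n, 1 ≤ ∑ m ∈ Finset.range n, c (m, cell m x)) :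
    content cell a A ≤ ∑' q, c q * a q.1 := by
  let s : ℕ → X → ℝ := fun n x => ∑ m ∈ Finset.range n, (c (m, cell m x) : ℝ)
  have hs : ∀ n x y, cell n x = cell n y → s n x = s n y := fun n x y h =>
    Finset.sum_congr rfl fun m hm => by
      rw [cell_eq_of_le hcell (Finset.mem_range.1 hm).le h]
  let F : ℝ → Set (ℕ × ι) := fun u =>
    {q | ∃ x, cell q.1 x = q.2 ∧ u ∈ Ioc (s q.1 x) (s (q.1 + 1) x)}
  have hF : ∀ q, ∃ I, MeasurableSet I ∧ {u | q ∈ F u} = I ∧ volume I ≤ c q := by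
    rintro ⟨n, k⟩
    by_cases h : ∃ x, cell n x = k
    · obtain ⟨x, rfl⟩ := h
      refine ⟨Ioc (s n x) (s (n + 1) x), measurableSet_Ioc, ?_, ?_⟩
      · ext u
        refine ⟨?_, fun hu => ⟨x, rfl, hu⟩⟩
        rintro ⟨y, hy, hu⟩
        have h1 : s n y = s n x := hs n y x hy
        have h2 : s (n + 1) y = s (n + 1) x := by
          have h3 : ∀ z, s (n + 1) z = s n z + c (n, cell n z) := fun z =>
            Finset.sum_range_succ _ _
          have hy' : cell n y = cell n x := hy
          rw [h3, h3, h1, hy']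
        rw [← h1, ← h2]
        exact hu
      · have h3 : s (n + 1) x = s n x + c (n, cell n x) := Finset.sum_range_succ _ _
        rw [Real.volume_Ioc, h3, add_sub_cancel_left, ENNReal.ofReal_coe_nnreal]
    · refine ⟨∅, MeasurableSet.empty, ?_, by simp⟩
      ext u
      simp only [mem_ofPred_eq, mem_empty_iff_false, iff_false]
      rintro ⟨x, hx, -⟩
      exact h ⟨x, hx⟩
  choose I hIm hI hIv using hF
  have hcov : ∀ u ∈ Ioc (0 : ℝ) 1, Covers cell (F u) A := by
    intro u hu x hx
    obtain ⟨n, hn⟩ := hc x hx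
    have hn' : u ≤ s n x := hu.2.trans (by
      have h1 := NNReal.coe_le_coe.2 hn
      rwa [NNReal.coe_sum, NNReal.coe_one] at h1)
    obtain ⟨k, hk, hkmin⟩ := exists_minimal_nat (p := fun k => u ≤ s k x) ⟨n, hn'⟩
    cases k with
    | zero => simp [s] at hk; linarith [hu.1]
    | succ k => exact ⟨k, x, rfl, not_le.1 (hkmin k k.lt_succ_self), hk⟩
  calc content cell a A = ∫⁻ _ in Ioc (0 : ℝ) 1, content cell a A := by simp
    _ ≤ ∫⁻ u in Ioc (0 : ℝ) 1, weight a (F u) :=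
      setLIntegral_mono' measurableSet_Ioc fun u hu => content_le (hcov u hu)
    _ ≤ ∫⁻ u, weight a (F u) := setLIntegral_le_lintegral _ _
    _ = ∫⁻ u, ∑' q : ℕ × ι, (I q).indicator (fun _ => a q.1) u := by
      refine lintegral_congr fun u => tsum_congr fun q => ?_
      have : q ∈ F u ↔ u ∈ I q := by rw [← hI q]; rfl
      by_cases h : u ∈ I q
      · rw [indicator_of_mem h, indicator_of_mem (this.2 h)]
      · rw [indicator_of_notMem h, indicator_of_notMem fun h' => h (this.1 h')]
    _ = ∑' q : ℕ × ι, a q.1 * volume (I q) := by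
      rw [lintegral_tsum fun q => (measurable_const.indicator (hIm q)).aemeasurable]
      exact tsum_congr fun q => lintegral_indicator_const (hIm q) _
    _ ≤ ∑' q, c q * a q.1 := ENNReal.tsum_le_tsum fun q => by
      rw [mul_comm]
      gcongr
      exact hIv q

variable {d : ℕ}

/-- The index of the half-open dyadic cube of side `2⁻ⁿ` containing `x`. -/
def dyadicCell (d n : ℕ) (x : EuclideanSpace ℝ (Fin d)) : Fin d → ℤ :=
  fun i => ⌊2 ^ n * x i⌋

/-- The weight `2⁻ⁿᵗ` of a dyadic cube of side `2⁻ⁿ`. -/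
def dyadicWeight (t : ℝ) (n : ℕ) : ℝ≥0∞ := ENNReal.ofReal ((2 ^ n)⁻¹ ^ t)

lemma dyadicCell_nested (n : ℕ) (x y : EuclideanSpace ℝ (Fin d))
    (h : dyadicCell d (n + 1) x = dyadicCell d (n + 1) y) :
    dyadicCell d n x = dyadicCell d n y := by
  have key : ∀ z : ℝ, ⌊2 ^ n * z⌋ = ⌊2 ^ (n + 1) * z⌋ / 2 := by
    intro z
    have : 2 ^ n * z = 2 ^ (n + 1) * z / (2 : ℕ) := by rw [pow_succ]; push_cast; ring
    rw [this, Int.floor_div_natCast]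
    rfl
  ext i
  have hi : ⌊2 ^ (n + 1) * x i⌋ = ⌊2 ^ (n + 1) * y i⌋ := congrFun h i
  simp only [dyadicCell]
  rw [key, key, hi]

lemma abs_sub_le_of_dyadicCell_eq {n : ℕ} {x y : EuclideanSpace ℝ (Fin d)}
    (h : dyadicCell d n x = dyadicCell d n y) (i : Fin d) : |x i - y i| ≤ (2 ^ n)⁻¹ := by
  have h2 : (0 : ℝ) < 2 ^ n := by positivity
  have h1 := Int.abs_sub_lt_one_of_floor_eq_floor (congrFun h i)
  rw [← mul_sub, abs_mul, abs_of_pos h2] at h1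
  rw [← one_div, le_div_iff₀ h2, mul_comm]
  exact h1.le

lemma dist_le_of_dyadicCell_eq {n : ℕ} {x y : EuclideanSpace ℝ (Fin d)}
    (h : dyadicCell d n x = dyadicCell d n y) : dist x y ≤ √d * (2 ^ n)⁻¹ := by
  rw [EuclideanSpace.dist_eq]
  calc √(∑ i, dist (x i) (y i) ^ 2) ≤ √(∑ _i : Fin d, ((2 ^ n)⁻¹ : ℝ) ^ 2) := by
        gcongr with i
        exact abs_sub_le_of_dyadicCell_eq h i
    _ = √d * (2 ^ n)⁻¹ := by
        rw [Finset.sum_const, Finset.card_univ, Fintype.card_fin, nsmul_eq_mul,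
          Real.sqrt_mul (Nat.cast_nonneg d), Real.sqrt_sq (by positivity)]

/-- A set of vanishing dyadic content has vanishing Hausdorff measure. -/
theorem hausdorffMeasure_eq_zero_of_content_eq_zero {t : ℝ} (ht : 0 < t)
    {A : Set (EuclideanSpace ℝ (Fin d))}
    (hA : content (dyadicCell d) (dyadicWeight t) A = 0) : μH[t] A = 0 := by
  have hex : ∀ j : ℕ, ∃ F, Covers (dyadicCell d) F A ∧
      weight (dyadicWeight t) F ≤ ((j : ℝ≥0∞) + 1)⁻¹ := by
    intro j
    have := exists_covers_weight_le (cell := dyadicCell d) (a := dyadicWeight t) (A := A)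
      (by simp [hA]) (ε := ((j : ℝ≥0∞) + 1)⁻¹) (by simp)
    simpa [hA] using this
  choose F hF hFw using hex
  let D : ℝ≥0∞ := ENNReal.ofReal (√d)
  let cube : ∀ j, F j → Set (EuclideanSpace ℝ (Fin d)) := fun j q =>
    {x | dyadicCell d q.1.1 x = q.1.2}
  have hdiam : ∀ j (q : F j), ediam (cube j q) ^ t ≤ D ^ t * dyadicWeight t q.1.1 := by
    intro j q
    have h1 : ediam (cube j q) ≤ D * ENNReal.ofReal (2 ^ q.1.1)⁻¹ := by
      refine ediam_le fun x hx y hy => ?_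
      rw [edist_dist, ← ENNReal.ofReal_mul (by positivity)]
      have hxy : dyadicCell d q.1.1 x = dyadicCell d q.1.1 y := by
        have hx' : dyadicCell d q.1.1 x = q.1.2 := hx
        have hy' : dyadicCell d q.1.1 y = q.1.2 := hy
        rw [hx', hy']
      exact ENNReal.ofReal_le_ofReal (dist_le_of_dyadicCell_eq hxy)
    calc ediam (cube j q) ^ t ≤ (D * ENNReal.ofReal (2 ^ q.1.1)⁻¹) ^ t :=
          ENNReal.rpow_le_rpow h1 ht.le
      _ = _ := by
          rw [ENNReal.mul_rpow_of_nonneg _ _ ht.le, dyadicWeight,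
            ← ENNReal.ofReal_rpow_of_nonneg (x := (2 ^ q.1.1)⁻¹) (by positivity) ht.le]
  have hsum : ∀ j, ∑' q : F j, dyadicWeight t q.1.1 ≤ ((j : ℝ≥0∞) + 1)⁻¹ := fun j => by
    refine le_trans (le_of_eq ?_) (hFw j)
    exact tsum_subtype (F j) fun q => dyadicWeight t q.1
  have hinv : Tendsto (fun j : ℕ => ((j : ℝ≥0∞) + 1)⁻¹) atTop (𝓝 0) := by
    have := ENNReal.tendsto_inv_nat_nhds_zero.comp (tendsto_add_atTop_nat 1)
    simpa [Function.comp_def] using this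
  have hD : D ^ t ≠ ∞ := ENNReal.rpow_ne_top_of_nonneg ht.le ENNReal.ofReal_ne_top
  have hinv' : Tendsto (fun j : ℕ => D ^ t * ((j : ℝ≥0∞) + 1)⁻¹) atTop (𝓝 0) := by
    simpa using ENNReal.Tendsto.const_mul hinv (Or.inr hD)
  have hr : Tendsto (fun j : ℕ => (D ^ t * ((j : ℝ≥0∞) + 1)⁻¹) ^ t⁻¹) atTop (𝓝 0) := by
    simpa [ENNReal.zero_rpow_of_pos (inv_pos.2 ht)] using hinv'.ennrpow_const t⁻¹
  have hle := Measure.hausdorffMeasure_le_liminf_tsum t A _ hr cube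
    (Eventually.of_forall fun j q => by
      rw [ENNReal.le_rpow_inv_iff ht]
      refine (hdiam j q).trans ?_
      gcongr
      exact (ENNReal.le_tsum q).trans (hsum j))
    (Eventually.of_forall fun j x hx => by
      obtain ⟨n, hn⟩ := hF j x hx
      exact mem_iUnion.2 ⟨⟨_, hn⟩, rfl⟩)
  have h0 : liminf (fun j => ∑' q : F j, ediam (cube j q) ^ t) atTop ≤ 0 := by
    rw [← hinv'.liminf_eq]
    refine liminf_le_liminf (Eventually.of_forall fun j => ?_)
    calc ∑' q : F j, ediam (cube j q) ^ t ≤ ∑' q : F j, D ^ t * dyadicWeight t q.1.1 :=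
          ENNReal.tsum_le_tsum (hdiam j)
      _ = D ^ t * ∑' q : F j, dyadicWeight t q.1.1 := ENNReal.tsum_mul_left
      _ ≤ _ := by gcongr; exact hsum j
  exact le_antisymm (hle.trans h0) zero_le

end DyadicContent

open scoped NNReal in
/-- Duality between weighted covers and measures: if every finite weighted cover of a compact space
by the sets `S j` costs at least `b > 0`, there is a nonzero finite measure giving mass at most
`w j` to the open subsets of `S j`. -/
theorem exists_measure_le_of_forall_weighted_cover {Y J : Type*} [TopologicalSpace Y]
    [CompactSpace Y] [T2Space Y] [MeasurableSpace Y] [BorelSpace Y] {S : J → Set Y}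
    (hSo : ∀ j, IsOpen (S j)) (hS : ∀ y, ∃ j, y ∈ S j) {w : J → ℝ} (hw : ∀ j, 0 ≤ w j)
    {b : ℝ} (hb : 0 < b)
    (hc : ∀ c : J →₀ ℝ≥0,
      (∀ y, 1 ≤ Finsupp.linearCombination ℝ≥0 (fun j => (S j).indicator (1 : Y → ℝ) y) c) →
      b ≤ Finsupp.linearCombination ℝ≥0 w c) :
    ∃ μ : Measure Y, IsFiniteMeasure μ ∧ μ ≠ 0 ∧
      ∀ j U, IsOpen U → U ⊆ S j → μ U ≤ ENNReal.ofReal (w j) := by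
  let E : Y → (J →₀ ℝ≥0) →ₗ[ℝ≥0] ℝ := fun y =>
    Finsupp.linearCombination ℝ≥0 (fun j => (S j).indicator (1 : Y → ℝ) y)
  let cost : (J →₀ ℝ≥0) →ₗ[ℝ≥0] ℝ := Finsupp.linearCombination ℝ≥0 w
  have hE0 : ∀ y c, 0 ≤ E y c := fun y c => by
    simp only [E, Finsupp.linearCombination_apply]
    exact Finset.sum_nonneg fun j _ =>
      smul_nonneg (c j).2 (indicator_nonneg (fun _ _ => zero_le_one) _)
  have hcost0 : ∀ c, 0 ≤ cost c := fun c => by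
    simp only [cost, Finsupp.linearCombination_apply]
    exact Finset.sum_nonneg fun j _ => smul_nonneg (c j).2 (hw j)
  let adm : C(Y, ℝ) → Set (J →₀ ℝ≥0) := fun f => {c | ∀ y, f y ≤ E y c}
  let p : C(Y, ℝ) → ℝ := fun f => sInf (cost '' adm f)
  have hbdd : ∀ f, BddBelow (cost '' adm f) := fun f =>
    ⟨0, by rintro _ ⟨c, -, rfl⟩; exact hcost0 c⟩
  have hple : ∀ f c, c ∈ adm f → p f ≤ cost c := fun f c h => csInf_le (hbdd f) ⟨c, h, rfl⟩
  have hp0 : ∀ f, 0 ≤ p f := fun f => Real.sInf_nonneg (by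
    rintro _ ⟨c, -, rfl⟩; exact hcost0 c)
  have hone : ∃ c, ∀ y, 1 ≤ E y c := by
    classical
    obtain ⟨s, hs⟩ := isCompact_univ.elim_finite_subcover S hSo
      fun y _ => mem_iUnion.2 (hS y)
    refine ⟨∑ j ∈ s, Finsupp.single j 1, fun y => ?_⟩
    obtain ⟨j, hj, hy⟩ := mem_iUnion₂.1 (hs (mem_univ y))
    simp only [E, map_sum, Finsupp.linearCombination_single, one_smul]
    refine le_trans (by rw [indicator_of_mem hy, Pi.one_apply])
      (Finset.single_le_sum (f := fun j => (S j).indicator (1 : Y → ℝ) y)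
        (fun j _ => indicator_nonneg (fun _ _ => zero_le_one) _) hj)
  have hne : ∀ f, (cost '' adm f).Nonempty := by
    intro f
    obtain ⟨c, hc⟩ := hone
    refine ⟨_, ⟨‖f‖₊ • c, fun y => ?_, rfl⟩⟩
    rw [map_smul]
    refine (le_abs_self (f y)).trans ((f.norm_coe_le_norm y).trans ?_)
    exact le_mul_of_one_le_right (norm_nonneg f) (hc y)
  have hadd : ∀ f g, p (f + g) ≤ p f + p g := by
    intro f g
    refine le_of_forall_pos_le_add fun ε hε => ?_
    obtain ⟨_, ⟨c, hcf, rfl⟩, h1⟩ := exists_lt_of_csInf_lt (hne f)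
      (lt_add_of_pos_right (p f) (half_pos hε))
    obtain ⟨_, ⟨e, heg, rfl⟩, h2⟩ := exists_lt_of_csInf_lt (hne g)
      (lt_add_of_pos_right (p g) (half_pos hε))
    have := hple (f + g) (c + e) fun y => by
      rw [map_add]; exact add_le_add (hcf y) (heg y)
    rw [map_add] at this
    linarith
  have hsmul_le : ∀ r : ℝ, 0 < r → ∀ f, p (r • f) ≤ r * p f := by
    intro r hr f
    rw [← div_le_iff₀' hr]
    refine le_csInf (hne f) ?_
    rintro _ ⟨c, hcf, rfl⟩
    rw [div_le_iff₀' hr]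
    lift r to ℝ≥0 using hr.le
    have h := hple ((r : ℝ) • f) (r • c) fun y => by
      rw [map_smul]
      exact mul_le_mul_of_nonneg_left (hcf y) r.2
    rw [map_smul] at h
    exact h
  have hsmul : ∀ r : ℝ, 0 < r → ∀ f, p (r • f) = r * p f := by
    intro r hr f
    refine le_antisymm (hsmul_le r hr f) ?_
    have h := hsmul_le r⁻¹ (inv_pos.2 hr) (r • f)
    rw [smul_smul, inv_mul_cancel₀ hr.ne', one_smul] at h
    rwa [← div_eq_inv_mul, le_div_iff₀' hr] at h
  have hp1 : b ≤ p 1 := by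
    refine le_csInf (hne 1) ?_
    rintro _ ⟨c, hc1, rfl⟩
    exact hc c hc1
  have h10 : (1 : C(Y, ℝ)) ≠ 0 := by
    intro h
    have := hple 0 0 fun y => by simp
    rw [map_zero, ← h] at this
    linarith
  obtain ⟨L, hL1, hLp⟩ := exists_extension_of_le_sublinear
    (LinearPMap.mkSpanSingleton (1 : C(Y, ℝ)) (p 1) h10) p hsmul hadd (by
      rintro ⟨x, hx⟩
      obtain ⟨r, rfl⟩ := Submodule.mem_span_singleton.1 hx
      rw [LinearPMap.mkSpanSingleton'_apply]
      rcases lt_or_ge 0 r with hr | hr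
      · exact (hsmul r hr 1).ge
      · exact (mul_nonpos_of_nonpos_of_nonneg hr (hp0 1)).trans (hp0 _))
  have hL1' : L 1 = p 1 := by
    have := hL1 ⟨1, Submodule.mem_span_singleton_self 1⟩
    rw [this, LinearPMap.mkSpanSingleton_apply]
  have hLnonneg : ∀ f : C(Y, ℝ), (∀ y, 0 ≤ f y) → 0 ≤ L f := by
    intro f hf
    have h1 := hLp (-f)
    have h2 := hple (-f) 0 fun y => by simpa using hf y
    rw [map_zero] at h2
    rw [map_neg] at h1
    linarith
  let Λ₀ : CompactlySupportedContinuousMap Y ℝ →ₗ[ℝ] ℝ :=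
    { toFun := fun f => L f.toContinuousMap
      map_add' := fun f g => L.map_add f.toContinuousMap g.toContinuousMap
      map_smul' := fun r f => L.map_smul r f.toContinuousMap }
  let Λ : CompactlySupportedContinuousMap Y ℝ →ₚ[ℝ] ℝ :=
    PositiveLinearMap.mk₀ Λ₀ fun f hf => hLnonneg _ hf
  let emb : C(Y, ℝ) → CompactlySupportedContinuousMap Y ℝ := fun f =>
    ⟨f, HasCompactSupport.of_compactSpace f⟩
  have hΛ : ∀ f, Λ (emb f) = L f := fun f => rfl
  refine ⟨RealRMK.rieszMeasure Λ, inferInstance, fun h0 => ?_, fun j U hU hUS => ?_⟩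
  · have h1 := RealRMK.integral_rieszMeasure Λ (emb 1)
    rw [h0, integral_zero_measure, hΛ, hL1'] at h1
    linarith
  · rw [hU.measure_eq_iSup_isCompact]
    refine iSup₂_le fun C hCU => iSup_le fun hC => ?_
    obtain ⟨f, hf0, hf1, hf⟩ := exists_continuous_zero_one_of_isClosed hU.isClosed_compl
      hC.isClosed (disjoint_compl_left_iff_subset.2 hCU)
    refine (RealRMK.rieszMeasure_le_of_eq_one Λ (f := emb f) (fun y => (hf y).1) hC
      fun y hy => hf1 hy).trans (ENNReal.ofReal_le_ofReal ?_)
    rw [hΛ]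
    refine (hLp f).trans ((hple f (Finsupp.single j 1) fun y => ?_).trans_eq (by
      simp [cost]))
    simp only [E, Finsupp.linearCombination_single, one_smul]
    by_cases hy : y ∈ U
    · rw [indicator_of_mem (hUS hy)]; exact (hf y).2
    · rw [hf0 hy]; exact indicator_nonneg (fun _ _ => zero_le_one) _

namespace DyadicContent

open Filter Topology
open scoped NNReal

variable {d : ℕ}

/-- The open cube of side `3 · 2⁻ⁿ` concentric with the dyadic cube `q` of side `2⁻ⁿ`. -/
def openStar (q : ℕ × (Fin d → ℤ)) : Set (EuclideanSpace ℝ (Fin d)) :=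
  {y | ∀ i, (q.2 i : ℝ) - 1 < 2 ^ q.1 * y i ∧ 2 ^ q.1 * y i < q.2 i + 2}

/-- The `3ᵈ` dyadic cubes of the same level as `q` that meet `openStar q`. -/
def neighbours (q : ℕ × (Fin d → ℤ)) : Finset (ℕ × (Fin d → ℤ)) :=
  {q.1} ×ˢ Finset.Icc (q.2 - 1) (q.2 + 1)

lemma isOpen_openStar (q : ℕ × (Fin d → ℤ)) : IsOpen (openStar q) := by
  simp only [openStar, ofPred_forall]
  refine isOpen_iInter_of_finite fun i => ?_
  have hc : Continuous fun y : EuclideanSpace ℝ (Fin d) => 2 ^ q.1 * y i := by fun_prop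
  exact (isOpen_lt continuous_const hc).inter (isOpen_lt hc continuous_const)

lemma card_neighbours (q : ℕ × (Fin d → ℤ)) : (neighbours q).card = 3 ^ d := by
  have h : ∀ i, q.2 i + 1 + 1 - (q.2 i - 1) = 3 := fun i => by ring
  simp [neighbours, Pi.card_Icc, h]

lemma mem_neighbours_of_mem_openStar {q : ℕ × (Fin d → ℤ)} {y : EuclideanSpace ℝ (Fin d)}
    (hy : y ∈ openStar q) : (q.1, dyadicCell d q.1 y) ∈ neighbours q := by
  simp only [neighbours, Finset.mem_product, Finset.mem_singleton, true_and, Finset.mem_Icc]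
  refine ⟨fun i => ?_, fun i => ?_⟩
  · have h : q.2 i - 1 ≤ ⌊2 ^ q.1 * y i⌋ := Int.le_floor.2 (by push_cast; exact (hy i).1.le)
    exact h
  · have h : ⌊2 ^ q.1 * y i⌋ < q.2 i + 2 := Int.floor_lt.2 (by push_cast; exact (hy i).2)
    have h' : ⌊2 ^ q.1 * y i⌋ ≤ q.2 i + 1 := by omega
    exact h'

lemma ball_subset_openStar (n : ℕ) (x : EuclideanSpace ℝ (Fin d)) :
    ball x (2 ^ n)⁻¹ ⊆ openStar (n, dyadicCell d n x) := by
  intro y hy i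
  have h2 : (0 : ℝ) < 2 ^ n := by positivity
  have h1 : |y i - x i| < (2 ^ n)⁻¹ :=
    lt_of_le_of_lt (by simpa using PiLp.norm_apply_le (y - x) i) (mem_ball_iff_norm.1 hy)
  have h1' : |(y i - x i) * 2 ^ n| < 1 := by
    rwa [abs_mul, abs_of_pos h2, ← lt_div_iff₀ h2, one_div]
  rw [abs_lt] at h1'
  have h3 := Int.floor_le (2 ^ n * x i)
  have h4 := Int.lt_floor_add_one (2 ^ n * x i)
  simp only [dyadicCell]
  constructor <;> linarith [h1'.1, h1'.2, sub_mul (y i) (x i) (2 ^ n)]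

/-- The set where a finite weighted family of open stars exceeds `1 / 2` has content at most a
constant times its cost. -/
lemma content_le_of_weighted_openStar (t : ℝ) (c : ℕ × (Fin d → ℤ) →₀ ℝ≥0) :
    content (dyadicCell d) (dyadicWeight t) {y | 1 / 2 < Finsupp.linearCombination ℝ≥0
      (fun q => (openStar q).indicator (1 : EuclideanSpace ℝ (Fin d) → ℝ) y) c} ≤
    ENNReal.ofReal (2 * 3 ^ d * Finsupp.linearCombination ℝ≥0
      (fun q : ℕ × (Fin d → ℤ) => ((2 ^ q.1)⁻¹ : ℝ) ^ t) c) := by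
  let c' : ℕ × (Fin d → ℤ) → ℝ≥0 := fun q' =>
    ∑ q ∈ c.support, if q' ∈ neighbours q then 2 * c q else 0
  refine (content_le_of_one_le_sum dyadicCell_nested c' fun x hx => ?_).trans (le_of_eq ?_)
  · obtain ⟨n, hn⟩ := (c.support.image Prod.fst).exists_nat_subset_range
    refine ⟨n, ?_⟩
    have h1 : ∀ q ∈ c.support, (2 * c q : ℝ) * (openStar q).indicator 1 x ≤
        ∑ m ∈ Finset.range n,
          ((if (m, dyadicCell d m x) ∈ neighbours q then 2 * c q else 0 : ℝ≥0) : ℝ) := by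
      intro q hq
      by_cases hxq : x ∈ openStar q
      · have hm : q.1 ∈ Finset.range n := hn (Finset.mem_image_of_mem _ hq)
        refine le_trans (le_of_eq ?_) (Finset.single_le_sum (fun m _ => NNReal.coe_nonneg _) hm)
        rw [if_pos (mem_neighbours_of_mem_openStar hxq), indicator_of_mem hxq]
        simp
      · rw [indicator_of_notMem hxq, mul_zero]
        exact Finset.sum_nonneg fun m _ => NNReal.coe_nonneg _
    have h2 := Finset.sum_le_sum h1
    have h3 : (1 : ℝ) < ∑ q ∈ c.support, (2 * c q : ℝ) * (openStar q).indicator 1 x := by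
      have hx' : 1 / 2 < Finsupp.linearCombination ℝ≥0
        (fun q => (openStar q).indicator (1 : EuclideanSpace ℝ (Fin d) → ℝ) x) c := hx
      rw [Finsupp.linearCombination_apply, Finsupp.sum] at hx'
      simp only [mul_assoc, ← Finset.mul_sum]
      simp only [NNReal.smul_def, smul_eq_mul] at hx'
      linarith
    rw [Finset.sum_comm] at h2
    rw [← NNReal.coe_le_coe]
    push_cast [c']
    linarith
  · have h1 : ∀ q' : ℕ × (Fin d → ℤ), (c' q' : ℝ≥0∞) * dyadicWeight t q'.1 =
        ∑ q ∈ c.support, if q' ∈ neighbours q then 2 * c q * dyadicWeight t q'.1 else 0 := by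
      intro q'
      simp only [c', ENNReal.ofNNReal_finsetSum, Finset.sum_mul]
      refine Finset.sum_congr rfl fun q _ => ?_
      split_ifs <;> simp
    have h2 : ∀ q : ℕ × (Fin d → ℤ), (∑' q' : ℕ × (Fin d → ℤ),
        if q' ∈ neighbours q then 2 * c q * dyadicWeight t q'.1 else 0) =
        2 * 3 ^ d * (c q * dyadicWeight t q.1) := by
      intro q
      rw [tsum_eq_sum (s := neighbours q) fun q' hq' => if_neg hq']
      rw [Finset.sum_congr rfl (g := fun _ => 2 * c q * dyadicWeight t q.1), Finset.sum_const,
        card_neighbours, nsmul_eq_mul]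
      · push_cast; ring
      · intro q' hq'
        rw [if_pos hq']
        simp only [neighbours, Finset.mem_product, Finset.mem_singleton] at hq'
        rw [hq'.1]
    simp_rw [h1]
    rw [Summable.tsum_finsetSum fun q _ => ENNReal.summable]
    simp_rw [h2]
    rw [← Finset.mul_sum, ENNReal.ofReal_mul (by positivity), Finsupp.linearCombination_apply,
      Finsupp.sum, ENNReal.ofReal_sum_of_nonneg fun q _ => by
        rw [NNReal.smul_def, smul_eq_mul]; positivity]
    congr 1
    · rw [ENNReal.ofReal_mul (by norm_num), ENNReal.ofReal_pow (by norm_num)]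
      norm_num
    · refine Finset.sum_congr rfl fun q _ => ?_
      rw [NNReal.smul_def, smul_eq_mul, ENNReal.ofReal_mul NNReal.zero_le_coe, dyadicWeight,
        ENNReal.ofReal_coe_nnreal]

end DyadicContent

open DyadicContent in
/-- **Frostman's lemma** for Borel subsets of Euclidean space. -/
theorem exists_frostman_measure {d : ℕ} {A : Set (EuclideanSpace ℝ (Fin d))}
    (hA : MeasurableSet A) {t : ℝ} (ht : 0 < t) (hAt : ENNReal.ofReal t < dimH A) :
    ∃ K ⊆ A, IsCompact K ∧ ∃ μ : Measure (EuclideanSpace ℝ (Fin d)), IsFiniteMeasure μ ∧ μ ≠ 0 ∧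
      μ Kᶜ = 0 ∧ ∃ C : ℝ, 0 ≤ C ∧ ∀ x r, 0 < r → μ.real (ball x r) ≤ C * r ^ t := by
  have hpos : content (dyadicCell d) (dyadicWeight t) A ≠ 0 := by
    intro h0
    have h1 := hausdorffMeasure_eq_zero_of_content_eq_zero ht h0
    have h2 := hausdorffMeasure_of_lt_dimH (d := t.toNNReal) hAt
    rw [Real.coe_toNNReal t ht.le, h1] at h2
    exact ENNReal.zero_ne_top h2
  obtain ⟨e, he0, heA⟩ := ENNReal.lt_iff_exists_nnreal_btwn.1 (pos_iff_ne_zero.2 hpos)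
  obtain ⟨K, hKA, hK, hKU⟩ := hA.analyticSet.exists_isCompact_forall_isOpen_lt
    (c := content (dyadicCell d) (dyadicWeight t)) (fun _ _ h => content_mono h)
    (fun B hB => content_iUnion_le dyadicCell_nested hB) heA
  refine ⟨K, hKA, hK, ?_⟩
  have : CompactSpace K := isCompact_iff_compactSpace.1 hK
  obtain ⟨ν, hνf, hν0, hν⟩ := exists_measure_le_of_forall_weighted_cover (Y := K)
    (S := fun q => Subtype.val ⁻¹' openStar q)
    (w := fun q : ℕ × (Fin d → ℤ) => ((2 ^ q.1)⁻¹ : ℝ) ^ t) (b := e / (2 * 3 ^ d))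
    (fun q => (isOpen_openStar q).preimage continuous_subtype_val)
    (fun y => ⟨_, ball_subset_openStar 0 y.1 (mem_ball_self (by norm_num))⟩)
    (fun q => by positivity)
    (by
      have : (0 : ℝ) < e := by exact_mod_cast he0
      positivity)
    (fun c hc => by
      have hopen : IsOpen {y | 1 / 2 < Finsupp.linearCombination NNReal
          (fun q => (openStar q).indicator (1 : EuclideanSpace ℝ (Fin d) → ℝ) y) c} := by
        have hlsc : LowerSemicontinuous fun y : EuclideanSpace ℝ (Fin d) =>
            ∑ q ∈ c.support, (openStar q).indicator (fun _ => (c q : ℝ)) y :=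
          lowerSemicontinuous_sum fun q _ =>
            (isOpen_openStar q).lowerSemicontinuous_indicator (c q).2
        convert hlsc.isOpen_preimage (1 / 2) using 1
        ext y
        rw [mem_ofPred_eq, Finsupp.linearCombination_apply, Finsupp.sum, mem_preimage, mem_Ioi]
        refine iff_of_eq (congrArg _ (Finset.sum_congr rfl fun q _ => ?_))
        by_cases h : y ∈ openStar q <;> simp [h, NNReal.smul_def]
      have h1 := (hKU _ hopen fun y hy => lt_of_lt_of_le (by norm_num) (hc ⟨y, hy⟩)).le.trans
        (content_le_of_weighted_openStar t c)
      rw [div_le_iff₀' (by positivity)]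
      refine (ENNReal.ofReal_le_ofReal_iff' (p := (e : ℝ)).1 ?_).resolve_right ?_
      · rwa [ENNReal.ofReal_coe_nnreal]
      · rw [not_le]; exact_mod_cast he0)
  have hdyadic : ∀ x n, (ν.map Subtype.val).real (ball x (2 ^ n)⁻¹) ≤ ((2 ^ n)⁻¹ : ℝ) ^ t := by
    intro x n
    refine ENNReal.toReal_le_of_le_ofReal (by positivity) ?_
    rw [Measure.map_apply measurable_subtype_coe measurableSet_ball]
    exact hν (n, dyadicCell d n x) _ (isOpen_ball.preimage continuous_subtype_val)
      (preimage_mono (ball_subset_openStar n x))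
  refine ⟨ν.map Subtype.val, inferInstance, ?_, ?_, ν.real univ + 2 ^ t, by positivity, ?_⟩
  · rwa [Ne, Measure.map_eq_zero_iff measurable_subtype_coe.aemeasurable]
  · rw [Measure.map_apply measurable_subtype_coe hK.measurableSet.compl]
    simp
  · intro x r hr
    rcases lt_or_ge r 1 with hr1 | hr1
    · obtain ⟨n, hn1, hn2⟩ := exists_nat_pow_near_of_lt_one hr hr1.le (y := (1 / 2 : ℝ))
        (by norm_num) (by norm_num)
      have h1 : r ≤ (2 ^ n)⁻¹ := by simpa using hn2
      have h2 : ((2 ^ n)⁻¹ : ℝ) ≤ 2 * r := by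
        rw [pow_succ, one_div, inv_pow] at hn1
        linarith
      calc (ν.map Subtype.val).real (ball x r) ≤ ((2 ^ n)⁻¹ : ℝ) ^ t :=
            (measureReal_mono (ball_subset_ball h1)).trans (hdyadic x n)
        _ ≤ (2 * r) ^ t := by gcongr
        _ = 2 ^ t * r ^ t := Real.mul_rpow (by norm_num) hr.le
        _ ≤ _ := by
            gcongr
            exact le_add_of_nonneg_left measureReal_nonneg
    · have h1 : (ν.map Subtype.val).real (ball x r) ≤ ν.real univ := by
        rw [map_measureReal_apply measurable_subtype_coe measurableSet_ball]
        exact measureReal_mono (subset_univ _)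
      have h2 : 1 ≤ r ^ t := Real.one_le_rpow hr1 ht.le
      have h3 : (0 : ℝ) < 2 ^ t := by positivity
      nlinarith [measureReal_nonneg (μ := ν) (s := univ)]

namespace GaussianEnergy

open Filter Topology
open scoped NNReal

theorem lintegral_exp_neg_le {Ω : Type*} [MeasurableSpace Ω] {m : Measure Ω} [IsFiniteMeasure m]
    {g : Ω → ℝ} (hg : Measurable g) (hg0 : ∀ x, 0 ≤ g x) {C p : ℝ} (hC : 0 ≤ C) (hp : p ≤ 1)
    (h : ∀ u, 0 < u → m.real {x | g x < u} ≤ C * u ^ p) :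
    ∫⁻ x, ENNReal.ofReal (Real.exp (-g x)) ∂m ≤
      ENNReal.ofReal ((∑' k : ℕ, Real.exp (-k) * (k + 1)) * C) := by
  have hsum : Summable fun k : ℕ => Real.exp (-k) * (k + 1 : ℝ) := by
    have h1 := Real.summable_pow_mul_exp_neg_nat_mul 1 one_pos
    have h0 := Real.summable_pow_mul_exp_neg_nat_mul 0 one_pos
    refine (h1.add h0).congr fun k => ?_
    simp only [pow_one, pow_zero, neg_mul, one_mul]
    ring
  calc ∫⁻ x, ENNReal.ofReal (Real.exp (-g x)) ∂m
      ≤ ∫⁻ x, ∑' k : ℕ, {x | g x < k + 1}.indicator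
          (fun _ => ENNReal.ofReal (Real.exp (-k))) x ∂m := by
        refine lintegral_mono fun x => ?_
        refine le_trans ?_ (ENNReal.le_tsum ⌊g x⌋₊)
        rw [indicator_of_mem (by simpa using Nat.lt_floor_add_one (g x))]
        exact ENNReal.ofReal_le_ofReal
          (Real.exp_le_exp.2 (neg_le_neg (Nat.floor_le (hg0 x))))
    _ = ∑' k : ℕ, ENNReal.ofReal (Real.exp (-k)) * m {x | g x < k + 1} := by
        rw [lintegral_tsum fun k => (measurable_const.indicator
          (measurableSet_lt hg measurable_const)).aemeasurable]
        exact tsum_congr fun k => lintegral_indicator_const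
          (measurableSet_lt hg measurable_const) _
    _ ≤ ∑' k : ℕ, ENNReal.ofReal (Real.exp (-k) * (k + 1) * C) := by
        refine ENNReal.tsum_le_tsum fun k => ?_
        have hk : (0 : ℝ) < k + 1 := by positivity
        have h1 : m {x | g x < k + 1} ≤ ENNReal.ofReal ((k + 1) * C) := by
          rw [← ofReal_measureReal]
          refine ENNReal.ofReal_le_ofReal ((h _ hk).trans ?_)
          rw [mul_comm]
          gcongr
          calc ((k : ℝ) + 1) ^ p ≤ (k + 1 : ℝ) ^ (1 : ℝ) :=
                Real.rpow_le_rpow_of_exponent_le (by linarith [(Nat.cast_nonneg k : (0:ℝ) ≤ k)]) hp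
            _ = k + 1 := Real.rpow_one _
        rw [mul_assoc, ENNReal.ofReal_mul (Real.exp_pos _).le]
        gcongr
    _ = _ := by
        rw [← tsum_mul_right, ENNReal.ofReal_tsum_of_nonneg (fun k => by positivity)
          (hsum.mul_right C)]

section Gaussian

variable {ι V : Type*} [Fintype ι] [NormedAddCommGroup V] [InnerProductSpace ℝ V]

theorem cos_mul_exp_eq_re (c a v : ι → ℝ) :
    Real.cos (∑ i, c i * v i) * Real.exp (-∑ i, a i * v i ^ 2) =
      (Complex.exp (-∑ i, (a i : ℂ) * (v i : ℂ) ^ 2 + ∑ i, (c i * Complex.I) * v i)).re := by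
  have : -∑ i, (a i : ℂ) * (v i : ℂ) ^ 2 + ∑ i, (c i * Complex.I) * v i =
      ((-∑ i, a i * v i ^ 2 : ℝ) : ℂ) + ((∑ i, c i * v i : ℝ) : ℂ) * Complex.I := by
    push_cast
    rw [Finset.sum_mul]
    congr 1
    exact Finset.sum_congr rfl fun i _ => by ring
  rw [this, Complex.exp_re, mul_comm]
  simp only [Complex.add_re, Complex.add_im, Complex.re_ofReal_mul, Complex.im_ofReal_mul,
    Complex.ofReal_re, Complex.ofReal_im, Complex.I_re, Complex.I_im, mul_zero, mul_one, add_zero,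
    zero_add]

theorem inner_repr_symm (B : OrthonormalBasis ι ℝ V) (v : ι → ℝ) (i : ι) :
    ⟪B i, B.repr.symm (WithLp.toLp 2 v)⟫ = v i := by
  rw [← B.repr_apply_apply]; simp

theorem inner_repr_symm_eq_sum (B : OrthonormalBasis ι ℝ V) (v : ι → ℝ) (z : V) :
    ⟪B.repr.symm (WithLp.toLp 2 v), z⟫ = ∑ i, ⟪B i, z⟫ * v i := by
  rw [← B.sum_inner_mul_inner]
  refine Finset.sum_congr rfl fun i _ => ?_
  rw [real_inner_comm, inner_repr_symm, mul_comm]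

variable [MeasurableSpace V] [BorelSpace V]

theorem measurableEmbedding_toLp_repr_symm (B : OrthonormalBasis ι ℝ V) :
    MeasurableEmbedding (fun v : ι → ℝ => B.repr.symm (WithLp.toLp 2 v)) :=
  B.repr.symm.toHomeomorph.measurableEmbedding.comp
    (MeasurableEquiv.toLp 2 (ι → ℝ)).measurableEmbedding

variable [FiniteDimensional ℝ V]

theorem measurePreserving_toLp_repr_symm (B : OrthonormalBasis ι ℝ V) :
    MeasurePreserving (fun v : ι → ℝ => B.repr.symm (WithLp.toLp 2 v)) :=
  B.measurePreserving_repr_symm.comp (PiLp.volume_preserving_toLp ι)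

theorem integrable_exp_neg_sum_inner (B : OrthonormalBasis ι ℝ V) {a : ι → ℝ}
    (ha : ∀ i, 0 < a i) :
    Integrable fun ξ : V => Real.exp (-∑ i, a i * ⟪B i, ξ⟫ ^ 2) := by
  rw [← (measurePreserving_toLp_repr_symm B).integrable_comp_emb
    (measurableEmbedding_toLp_repr_symm B)]
  have h := (GaussianFourier.integrable_cexp_neg_sum_mul_add
    (b := fun i => (a i : ℂ)) (fun i => by simpa using ha i) (fun _ => 0)).re
  refine h.congr (ae_of_all _ fun v => ?_)
  have := cos_mul_exp_eq_re (fun _ => 0) a v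
  simp only [inner_repr_symm, Function.comp_def]
  simpa using this.symm

theorem integral_cos_mul_exp_neg_sum_inner (B : OrthonormalBasis ι ℝ V) {a : ι → ℝ}
    (ha : ∀ i, 0 < a i) (z : V) :
    ∫ ξ : V, Real.cos ⟪ξ, z⟫ * Real.exp (-∑ i, a i * ⟪B i, ξ⟫ ^ 2) =
      (∏ i, √(Real.pi / a i)) * Real.exp (-∑ i, ⟪B i, z⟫ ^ 2 / (4 * a i)) := by
  rw [← (measurePreserving_toLp_repr_symm B).integral_comp
    (measurableEmbedding_toLp_repr_symm B)]
  have hb : ∀ i, 0 < ((a i : ℂ)).re := fun i => by simpa using ha i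
  simp only [inner_repr_symm, inner_repr_symm_eq_sum, cos_mul_exp_eq_re]
  have h_int := GaussianFourier.integrable_cexp_neg_sum_mul_add hb
    (fun i => (⟪B i, z⟫ : ℂ) * Complex.I)
  have := integral_re h_int
  simp only [RCLike.re_eq_complex_re] at this
  rw [this, GaussianFourier.integral_cexp_neg_sum_mul_add hb]
  have h2 : ∏ i, ((Real.pi : ℂ) / a i) ^ (1 / 2 : ℂ) *
      Complex.exp ((⟪B i, z⟫ * Complex.I) ^ 2 / (4 * a i)) =
      (((∏ i, √(Real.pi / a i)) * Real.exp (-∑ i, ⟪B i, z⟫ ^ 2 / (4 * a i)) : ℝ) : ℂ) := by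
    rw [← Finset.sum_neg_distrib, Real.exp_sum, ← Finset.prod_mul_distrib, Complex.ofReal_prod]
    refine Finset.prod_congr rfl fun i _ => ?_
    rw [Complex.ofReal_mul, Real.sqrt_eq_rpow,
      Complex.ofReal_cpow (div_nonneg Real.pi_pos.le (ha i).le)]
    push_cast
    rw [mul_pow, Complex.I_sq]
    congr 2
    ring
  rw [h2, Complex.ofReal_re]

end Gaussian

section PowerSpectrum

variable {V : Type*} [NormedAddCommGroup V] [InnerProductSpace ℝ V]
  [MeasurableSpace V] [BorelSpace V] [SecondCountableTopology V]

/-- The squared modulus of the Fourier transform of `μ`, as a real integral over `μ × μ`. -/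
def powerSpectrum (μ : Measure V) (ξ : V) : ℝ :=
  ∫ p, Real.cos ⟪ξ, p.1 - p.2⟫ ∂μ.prod μ

theorem powerSpectrum_eq_sq_add_sq (μ : Measure V) [IsFiniteMeasure μ] (ξ : V) :
    powerSpectrum μ ξ = (∫ x, Real.cos ⟪ξ, x⟫ ∂μ) ^ 2 + (∫ x, Real.sin ⟪ξ, x⟫ ∂μ) ^ 2 := by
  have hc : Integrable (fun x => Real.cos ⟪ξ, x⟫) μ :=
    Integrable.of_bound (by fun_prop) 1 (ae_of_all _ fun x => Real.abs_cos_le_one _)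
  have hs : Integrable (fun x => Real.sin ⟪ξ, x⟫) μ :=
    Integrable.of_bound (by fun_prop) 1 (ae_of_all _ fun x => Real.abs_sin_le_one _)
  simp only [powerSpectrum, inner_sub_right, Real.cos_sub]
  rw [integral_add (hc.mul_prod hc) (hs.mul_prod hs),
    integral_prod_mul (fun x => Real.cos ⟪ξ, x⟫) (fun x => Real.cos ⟪ξ, x⟫),
    integral_prod_mul (fun x => Real.sin ⟪ξ, x⟫) (fun x => Real.sin ⟪ξ, x⟫), sq, sq]

theorem powerSpectrum_nonneg (μ : Measure V) [IsFiniteMeasure μ] (ξ : V) :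
    0 ≤ powerSpectrum μ ξ := by
  rw [powerSpectrum_eq_sq_add_sq]
  positivity

theorem stronglyMeasurable_powerSpectrum (μ : Measure V) [IsFiniteMeasure μ] :
    StronglyMeasurable (powerSpectrum μ) := by
  have h : Continuous fun q : V × V × V => Real.cos ⟪q.1, q.2.1 - q.2.2⟫ := by fun_prop
  exact h.stronglyMeasurable.integral_prod_right

theorem lintegral_powerSpectrum_mul_exp {ι : Type*} [Fintype ι] [FiniteDimensional ℝ V]
    (μ : Measure V) [IsFiniteMeasure μ] (B : OrthonormalBasis ι ℝ V) {a : ι → ℝ}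
    (ha : ∀ i, 0 < a i) :
    ∫⁻ ξ, ENNReal.ofReal (powerSpectrum μ ξ * Real.exp (-∑ i, a i * ⟪B i, ξ⟫ ^ 2)) =
      ENNReal.ofReal (∏ i, √(Real.pi / a i)) *
        ∫⁻ p, ENNReal.ofReal (Real.exp (-∑ i, ⟪B i, p.1 - p.2⟫ ^ 2 / (4 * a i))) ∂μ.prod μ := by
  have hh := integrable_exp_neg_sum_inner B ha
  have hprod : Integrable (fun q : V × V × V => Real.cos ⟪q.1, q.2.1 - q.2.2⟫ *
      Real.exp (-∑ i, a i * ⟪B i, q.1⟫ ^ 2)) (volume.prod (μ.prod μ)) := by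
    refine (hh.comp_fst (μ.prod μ)).mono' (by fun_prop) (ae_of_all _ fun q => ?_)
    rw [norm_mul, Real.norm_eq_abs, Real.norm_eq_abs, Real.abs_exp]
    exact mul_le_of_le_one_left (Real.exp_pos _).le (Real.abs_cos_le_one _)
  have hexp : Integrable (fun p : V × V =>
      Real.exp (-∑ i, ⟪B i, p.1 - p.2⟫ ^ 2 / (4 * a i))) (μ.prod μ) := by
    refine Integrable.of_bound (by fun_prop) 1 (ae_of_all _ fun p => ?_)
    rw [Real.norm_eq_abs, Real.abs_exp, Real.exp_le_one_iff, neg_nonpos]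
    exact Finset.sum_nonneg fun i _ => div_nonneg (sq_nonneg _) (by linarith [ha i])
  have h_int : Integrable fun ξ => powerSpectrum μ ξ * Real.exp (-∑ i, a i * ⟪B i, ξ⟫ ^ 2) := by
    refine hprod.integral_prod_left.congr (ae_of_all _ fun ξ => ?_)
    simp only [powerSpectrum]
    rw [integral_mul_const]
  rw [← ofReal_integral_eq_lintegral_ofReal h_int
      (ae_of_all _ fun ξ => mul_nonneg (powerSpectrum_nonneg μ ξ) (Real.exp_pos _).le),
    ← ofReal_integral_eq_lintegral_ofReal hexp (ae_of_all _ fun p => (Real.exp_pos _).le),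
    ← ENNReal.ofReal_mul (Finset.prod_nonneg fun i _ => Real.sqrt_nonneg _),
    ← integral_const_mul]
  congr 1
  calc ∫ ξ, powerSpectrum μ ξ * Real.exp (-∑ i, a i * ⟪B i, ξ⟫ ^ 2)
      = ∫ ξ, ∫ p, Real.cos ⟪ξ, p.1 - p.2⟫ * Real.exp (-∑ i, a i * ⟪B i, ξ⟫ ^ 2) ∂μ.prod μ := by
        refine integral_congr_ae (ae_of_all _ fun ξ => ?_)
        simp only [powerSpectrum]
        rw [integral_mul_const]
    _ = _ := by
        rw [integral_integral_swap hprod]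
        exact integral_congr_ae (ae_of_all _ fun p => integral_cos_mul_exp_neg_sum_inner B ha _)

end PowerSpectrum

end GaussianEnergy

namespace EuclideanPlane

/-- The rotation of the plane by a right angle. -/
def rot : EuclideanSpace ℝ (Fin 2) →L[ℝ] EuclideanSpace ℝ (Fin 2) :=
  LinearMap.toContinuousLinearMap
    { toFun := fun x => !₂[-x 1, x 0]
      map_add' := fun x y => by ext i; fin_cases i <;> simp [add_comm]
      map_smul' := fun c x => by ext i; fin_cases i <;> simp }

@[simp] theorem rot_apply_zero (x : EuclideanSpace ℝ (Fin 2)) : rot x 0 = -x 1 := rfl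

@[simp] theorem rot_apply_one (x : EuclideanSpace ℝ (Fin 2)) : rot x 1 = x 0 := rfl

theorem inner_eq (x y : EuclideanSpace ℝ (Fin 2)) : ⟪x, y⟫ = x 0 * y 0 + x 1 * y 1 := by
  simp [PiLp.inner_apply, Fin.sum_univ_two, mul_comm]

theorem norm_sq_eq (x : EuclideanSpace ℝ (Fin 2)) : ‖x‖ ^ 2 = x 0 ^ 2 + x 1 ^ 2 := by
  rw [EuclideanSpace.real_norm_sq_eq, Fin.sum_univ_two]

theorem rot_rot (x : EuclideanSpace ℝ (Fin 2)) : rot (rot x) = -x := by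
  ext i; fin_cases i <;> simp

@[simp] theorem norm_rot (x : EuclideanSpace ℝ (Fin 2)) : ‖rot x‖ = ‖x‖ := by
  rw [← sq_eq_sq₀ (norm_nonneg _) (norm_nonneg _), norm_sq_eq, norm_sq_eq]
  simp [add_comm]

@[simp] theorem inner_rot_self (x : EuclideanSpace ℝ (Fin 2)) : ⟪rot x, x⟫ = 0 := by
  rw [inner_eq]; simp; ring

theorem inner_sq_add_inner_rot_sq (x y : EuclideanSpace ℝ (Fin 2)) :
    ⟪x, y⟫ ^ 2 + ⟪rot x, y⟫ ^ 2 = ‖x‖ ^ 2 * ‖y‖ ^ 2 := by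
  rw [norm_sq_eq, norm_sq_eq, inner_eq, inner_eq]; simp; ring

theorem exists_orthonormalBasis_rot {x : EuclideanSpace ℝ (Fin 2)} (hx : ‖x‖ = 1) :
    ∃ B : OrthonormalBasis (Fin 2) ℝ (EuclideanSpace ℝ (Fin 2)), B 0 = x ∧ B 1 = rot x := by
  have ho : Orthonormal ℝ ((univ : Set (Fin 2)).domRestrict ![x, rot x]) := by
    refine Orthonormal.comp (v := ![x, rot x]) ?_ _ Subtype.val_injective
    refine ⟨fun i => by fin_cases i <;> simp [hx], fun i j hij => ?_⟩
    fin_cases i <;> fin_cases j <;> simp [real_inner_comm] at hij ⊢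
    · rw [real_inner_comm, inner_rot_self]
    · rw [real_inner_comm, inner_rot_self]
  obtain ⟨B, hB⟩ := ho.exists_orthonormalBasis_extension_of_card_eq (by simp)
  exact ⟨B, hB 0 trivial, hB 1 trivial⟩

end EuclideanPlane

namespace GaussianEnergy

open Filter Topology EuclideanPlane
open scoped NNReal

local notation "ℝ²" => EuclideanSpace ℝ (Fin 2)

theorem lintegral_powerSpectrum_mul_exp_norm_sq (μ : Measure ℝ²) [IsFiniteMeasure μ] {s : ℝ}
    (hs : 0 < s) :
    ∫⁻ ξ, ENNReal.ofReal (powerSpectrum μ ξ * Real.exp (-(s * ‖ξ‖ ^ 2))) =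
      ENNReal.ofReal (Real.pi / s) *
        ∫⁻ p, ENNReal.ofReal (Real.exp (-(‖p.1 - p.2‖ ^ 2 / (4 * s)))) ∂μ.prod μ := by
  have h := lintegral_powerSpectrum_mul_exp μ (EuclideanSpace.basisFun (Fin 2) ℝ)
    (a := fun _ => s) (fun _ => hs)
  have h1 : ∀ ξ : ℝ², ∑ i, s * ⟪EuclideanSpace.basisFun (Fin 2) ℝ i, ξ⟫ ^ 2 = s * ‖ξ‖ ^ 2 := by
    intro ξ
    rw [← Finset.mul_sum, ← (EuclideanSpace.basisFun (Fin 2) ℝ).sum_sq_inner_right]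
  have h2 : ∀ ξ : ℝ², ∑ i, ⟪EuclideanSpace.basisFun (Fin 2) ℝ i, ξ⟫ ^ 2 / (4 * s) =
      ‖ξ‖ ^ 2 / (4 * s) := by
    intro ξ
    rw [← Finset.sum_div, ← (EuclideanSpace.basisFun (Fin 2) ℝ).sum_sq_inner_right]
  simp only [h1, h2, Finset.prod_const, Finset.card_univ, Fintype.card_fin] at h
  rwa [Real.sq_sqrt (div_nonneg Real.pi_pos.le hs.le)] at h

theorem lintegral_powerSpectrum_mul_exp_rot (μ : Measure ℝ²) [IsFiniteMeasure μ] {a : ℝ}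
    (ha : 0 < a) {θ : ℝ²} (hθ : ‖θ‖ = 1) :
    ∫⁻ p, ENNReal.ofReal (Real.exp
        (-(⟪θ, p.1 - p.2⟫ ^ 2 / (4 * a) + ⟪rot θ, p.1 - p.2⟫ ^ 2 / 4))) ∂μ.prod μ ≤
      ENNReal.ofReal (√a / Real.pi) *
        ∫⁻ ξ, ENNReal.ofReal (powerSpectrum μ ξ * Real.exp (-⟪rot θ, ξ⟫ ^ 2)) := by
  obtain ⟨B, hB0, hB1⟩ := exists_orthonormalBasis_rot hθ
  have h := lintegral_powerSpectrum_mul_exp μ B (a := ![a, 1])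
    (fun i => by fin_cases i <;> simp [ha])
  simp only [Fin.sum_univ_two, Fin.prod_univ_two, hB0, hB1, Matrix.cons_val_zero,
    Matrix.cons_val_one, mul_one, div_one, one_mul] at h
  have hc : √a / Real.pi * (√(Real.pi / a) * √Real.pi) = 1 := by
    rw [Real.sqrt_div Real.pi_pos.le, div_mul_eq_mul_div _ (√a), Real.mul_self_sqrt Real.pi_pos.le]
    have := (Real.sqrt_pos.2 ha).ne'
    have := Real.pi_pos.ne'
    field_simp
  calc _ = ENNReal.ofReal (√a / Real.pi) * ∫⁻ ξ, ENNReal.ofReal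
        (powerSpectrum μ ξ * Real.exp (-(a * ⟪θ, ξ⟫ ^ 2 + ⟪rot θ, ξ⟫ ^ 2))) := by
        rw [h, ← mul_assoc, ← ENNReal.ofReal_mul (by positivity), hc, ENNReal.ofReal_one, one_mul]
    _ ≤ _ := by
        gcongr with ξ
        · exact powerSpectrum_nonneg μ ξ
        · have : 0 ≤ a * ⟪θ, ξ⟫ ^ 2 := by positivity
          linarith

theorem lintegral_exp_neg_norm_sq_le {μ : Measure ℝ²} [IsFiniteMeasure μ] {C t : ℝ} (hC : 0 ≤ C)
    (ht : t ≤ 2) (hμ : ∀ x r, 0 < r → μ.real (ball x r) ≤ C * r ^ t) {s : ℝ} (hs : 0 < s) :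
    ∫⁻ p, ENNReal.ofReal (Real.exp (-(‖p.1 - p.2‖ ^ 2 / (4 * s)))) ∂μ.prod μ ≤
      ENNReal.ofReal ((∑' k : ℕ, Real.exp (-k) * (k + 1)) * (C * (4 * s) ^ (t / 2))) * μ univ := by
  rw [lintegral_prod _ (by fun_prop), ← lintegral_const]
  refine lintegral_mono fun x => ?_
  refine lintegral_exp_neg_le (p := t / 2) (by fun_prop) (fun y => by positivity) (by positivity)
    (by linarith) fun u hu => ?_
  have h : {y | ‖x - y‖ ^ 2 / (4 * s) < u} = ball x √(4 * s * u) := by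
    ext y
    rw [mem_ball, dist_eq_norm, norm_sub_rev, Real.lt_sqrt (norm_nonneg _), Set.mem_ofPred_eq,
      div_lt_iff₀ (by positivity), mul_comm u]
  dsimp only
  rw [h]
  refine (hμ x _ (Real.sqrt_pos.2 (by positivity))).trans_eq ?_
  rw [mul_assoc C, ← Real.mul_rpow (by positivity) hu.le, Real.sqrt_eq_rpow, ← Real.rpow_mul
    (by positivity), one_div_mul_eq_div]

theorem exists_lintegral_exp_neg_inner_rot_le {ν : Measure ℝ²} [IsFiniteMeasure ν]
    (hνS : ν (sphere 0 1)ᶜ = 0) {C τ : ℝ} (hC : 0 ≤ C) (hτ0 : 0 < τ)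
    (hτ : τ ≤ 2) (hν : ∀ x r, 0 < r → ν.real (ball x r) ≤ C * r ^ τ) :
    ∃ D : ℝ, 0 ≤ D ∧ ∀ ξ, ∫⁻ θ, ENNReal.ofReal (Real.exp (-⟪rot θ, ξ⟫ ^ 2)) ∂ν ≤
      ENNReal.ofReal (D * (1 + ‖ξ‖ ^ 2) ^ (-(τ / 2))) := by
  set κ : ℝ := ∑' k : ℕ, Real.exp (-k) * (k + 1)
  have hκ : 0 ≤ κ := tsum_nonneg fun k => by positivity
  refine ⟨2 * ν.real univ + κ * (2 * C * 2 ^ τ) * 2, by positivity, fun ξ => ?_⟩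
  rcases lt_or_ge ‖ξ‖ 1 with hξ | hξ
  · calc ∫⁻ θ, ENNReal.ofReal (Real.exp (-⟪rot θ, ξ⟫ ^ 2)) ∂ν ≤ ∫⁻ _, 1 ∂ν := by
          refine lintegral_mono fun θ => ?_
          rw [ENNReal.ofReal_le_one, Real.exp_le_one_iff]
          linarith [sq_nonneg ⟪rot θ, ξ⟫]
      _ = ENNReal.ofReal (ν.real univ) := by simp
      _ ≤ _ := by
        refine ENNReal.ofReal_le_ofReal ?_
        have h2 : (1 / 2 : ℝ) ≤ (1 + ‖ξ‖ ^ 2) ^ (-(τ / 2)) := by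
          calc (1 / 2 : ℝ) = 2 ^ (-1 : ℝ) := by rw [Real.rpow_neg_one]; norm_num
            _ ≤ 2 ^ (-(τ / 2)) := Real.rpow_le_rpow_of_exponent_le (by norm_num) (by linarith)
            _ ≤ _ := Real.rpow_le_rpow_of_nonpos (by positivity)
              (by nlinarith [norm_nonneg ξ]) (by linarith)
        have h3 : 0 ≤ κ * (2 * C * 2 ^ τ) * 2 := by positivity
        calc ν.real univ = (2 * ν.real univ) * (1 / 2) := by ring
          _ ≤ _ := by gcongr; linarith
  · have hξ0 : 0 < ‖ξ‖ := by linarith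
    have hsub : ∀ u, 0 < u → ν.real {θ | ⟪rot θ, ξ⟫ ^ 2 < u} ≤
        (2 * C * (2 / ‖ξ‖) ^ τ) * u ^ (τ / 2) := by
      intro u hu
      set ρ := 2 / ‖ξ‖ * √u
      have hρ : 0 < ρ := by positivity
      have hρ2 : ρ ^ 2 = 4 * u / ‖ξ‖ ^ 2 := by
        rw [mul_pow, Real.sq_sqrt hu.le, div_pow]; ring
      set e := ‖ξ‖⁻¹ • ξ
      have he : ‖e‖ = 1 := by rw [norm_smul, norm_inv, norm_norm, inv_mul_cancel₀ hξ0.ne']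
      have hcov : {θ | ⟪rot θ, ξ⟫ ^ 2 < u} ⊆ (ball e ρ ∪ ball (-e) ρ) ∪ (sphere 0 1)ᶜ := by
        intro θ hθ
        by_cases hθ1 : θ ∈ sphere (0 : ℝ²) 1
        swap
        · exact Or.inr hθ1
        left
        rw [mem_sphere_zero_iff_norm] at hθ1
        have h1 := inner_sq_add_inner_rot_sq θ e
        rw [hθ1, he] at h1
        have h2 : ⟪rot θ, e⟫ ^ 2 < u / ‖ξ‖ ^ 2 := by
          rw [inner_smul_right, mul_pow, inv_pow, div_eq_inv_mul]
          gcongr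
          exact hθ
        have h4 : ρ ^ 2 = 4 * (u / ‖ξ‖ ^ 2) := by rw [hρ2]; ring
        have hn := norm_sub_sq_real θ e
        have hn' := norm_add_sq_real θ e
        rw [hθ1, he] at hn hn'
        rcases le_total 0 ⟪θ, e⟫ with hc | hc
        · left
          rw [mem_ball, dist_eq_norm]
          refine lt_of_pow_lt_pow_left₀ 2 hρ.le ?_
          nlinarith [mul_nonneg hc (sq_nonneg ⟪rot θ, e⟫), sq_nonneg (1 - ⟪θ, e⟫)]
        · right
          rw [mem_ball, dist_eq_norm, sub_neg_eq_add]
          refine lt_of_pow_lt_pow_left₀ 2 hρ.le ?_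
          nlinarith [sq_nonneg (1 + ⟪θ, e⟫)]
      calc ν.real {θ | ⟪rot θ, ξ⟫ ^ 2 < u}
          ≤ ν.real ((ball e ρ ∪ ball (-e) ρ) ∪ (sphere 0 1)ᶜ) := measureReal_mono hcov
        _ ≤ ν.real (ball e ρ ∪ ball (-e) ρ) + ν.real (sphere 0 1)ᶜ := measureReal_union_le _ _
        _ ≤ (ν.real (ball e ρ) + ν.real (ball (-e) ρ)) + 0 := by
            gcongr
            · exact measureReal_union_le _ _
            · simp [Measure.real, hνS]
        _ ≤ (C * ρ ^ τ + C * ρ ^ τ) + 0 := by gcongr <;> exact hν _ _ hρ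
        _ = _ := by
            rw [Real.mul_rpow (by positivity) (by positivity), Real.sqrt_eq_rpow,
              ← Real.rpow_mul hu.le, one_div_mul_eq_div]
            ring
    refine (lintegral_exp_neg_le (g := fun θ => ⟪rot θ, ξ⟫ ^ 2) (by fun_prop)
      (fun θ => sq_nonneg _) (by positivity) (by linarith : τ / 2 ≤ 1) hsub).trans ?_
    refine ENNReal.ofReal_le_ofReal ?_
    have h1 : ‖ξ‖⁻¹ ^ τ ≤ 2 * (1 + ‖ξ‖ ^ 2) ^ (-(τ / 2)) := by
      calc ‖ξ‖⁻¹ ^ τ = (‖ξ‖ ^ 2) ^ (-(τ / 2)) := by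
            rw [← Real.rpow_natCast, ← Real.rpow_mul hξ0.le, Real.inv_rpow hξ0.le,
              ← Real.rpow_neg hξ0.le]
            congr 1
            push_cast
            ring
        _ ≤ ((1 + ‖ξ‖ ^ 2) / 2) ^ (-(τ / 2)) :=
            Real.rpow_le_rpow_of_nonpos (by positivity) (by nlinarith) (by linarith)
        _ = 2 ^ (τ / 2) * (1 + ‖ξ‖ ^ 2) ^ (-(τ / 2)) := by
            rw [Real.div_rpow (by positivity) (by norm_num),
              Real.rpow_neg (by norm_num : (0:ℝ) ≤ 2),
              div_inv_eq_mul, mul_comm]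
        _ ≤ 2 ^ (1 : ℝ) * (1 + ‖ξ‖ ^ 2) ^ (-(τ / 2)) := by
            gcongr
            · norm_num
            · linarith
        _ = _ := by rw [Real.rpow_one]
    calc κ * (2 * C * (2 / ‖ξ‖) ^ τ) = κ * (2 * C * 2 ^ τ) * ‖ξ‖⁻¹ ^ τ := by
          rw [div_eq_mul_inv, Real.mul_rpow (by norm_num) (by positivity)]; ring
      _ ≤ κ * (2 * C * 2 ^ τ) * (2 * (1 + ‖ξ‖ ^ 2) ^ (-(τ / 2))) := by gcongr
      _ = κ * (2 * C * 2 ^ τ) * 2 * (1 + ‖ξ‖ ^ 2) ^ (-(τ / 2)) := by ring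
      _ ≤ _ := by
        gcongr
        linarith [measureReal_nonneg (μ := ν) (s := univ)]

theorem ofReal_rpow_neg_eq_lintegral {b r : ℝ} (hb : 0 < b) (hr : 0 < r) :
    ENNReal.ofReal (r ^ (-b)) = ENNReal.ofReal (Real.Gamma b)⁻¹ *
      ∫⁻ s in Ioi 0, ENNReal.ofReal (s ^ (b - 1) * Real.exp (-(r * s))) := by
  have h := Real.integral_rpow_mul_exp_neg_mul_Ioi hb hr
  have hΓ := Real.Gamma_pos_of_pos hb
  have h_int : IntegrableOn (fun s : ℝ => s ^ (b - 1) * Real.exp (-(r * s))) (Ioi 0) := by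
    refine not_imp_comm.1 integral_undef ?_
    rw [h]
    positivity
  rw [← ofReal_integral_eq_lintegral_ofReal h_int, h, ← ENNReal.ofReal_mul (by positivity),
    one_div, Real.inv_rpow hr.le, ← Real.rpow_neg hr.le]
  · congr 1
    field_simp
  · filter_upwards [ae_restrict_mem measurableSet_Ioi] with s hs
    rw [mem_Ioi] at hs
    exact mul_nonneg (Real.rpow_nonneg hs.le _) (Real.exp_pos _).le

theorem lintegral_powerSpectrum_mul_rpow_lt_top {μ : Measure ℝ²} [IsFiniteMeasure μ] {C t τ : ℝ}
    (hC : 0 ≤ C) (ht : t ≤ 2) (hμ : ∀ x r, 0 < r → μ.real (ball x r) ≤ C * r ^ t)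
    (hτ : 0 < τ) (hτt : 2 < τ + t) :
    ∫⁻ ξ, ENNReal.ofReal (powerSpectrum μ ξ * (1 + ‖ξ‖ ^ 2) ^ (-(τ / 2))) < ∞ := by
  set κ : ℝ := ∑' k : ℕ, Real.exp (-k) * (k + 1)
  have hκ : 0 ≤ κ := tsum_nonneg fun k => by positivity
  have hmeas := (stronglyMeasurable_powerSpectrum μ).measurable
  calc ∫⁻ ξ, ENNReal.ofReal (powerSpectrum μ ξ * (1 + ‖ξ‖ ^ 2) ^ (-(τ / 2)))
      = ∫⁻ ξ : ℝ², ENNReal.ofReal (Real.Gamma (τ / 2))⁻¹ * ∫⁻ s in Ioi (0 : ℝ),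
          ENNReal.ofReal (s ^ (τ / 2 - 1) * Real.exp (-s)) *
          ENNReal.ofReal (powerSpectrum μ ξ * Real.exp (-(s * ‖ξ‖ ^ 2))) := by
        refine lintegral_congr fun ξ => ?_
        rw [ENNReal.ofReal_mul (powerSpectrum_nonneg μ ξ),
          ofReal_rpow_neg_eq_lintegral (by positivity) (by positivity), mul_left_comm,
          ← lintegral_const_mul _ (by fun_prop)]
        congr 1
        refine setLIntegral_congr_fun measurableSet_Ioi fun s hs => ?_
        rw [mem_Ioi] at hs
        rw [← ENNReal.ofReal_mul (powerSpectrum_nonneg μ ξ), ← ENNReal.ofReal_mul (by positivity),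
          show -((1 + ‖ξ‖ ^ 2) * s) = -s + -(s * ‖ξ‖ ^ 2) by ring, Real.exp_add]
        congr 1
        ring
    _ = ENNReal.ofReal (Real.Gamma (τ / 2))⁻¹ * ∫⁻ s in Ioi (0 : ℝ),
          ENNReal.ofReal (s ^ (τ / 2 - 1) * Real.exp (-s)) *
          ∫⁻ ξ, ENNReal.ofReal (powerSpectrum μ ξ * Real.exp (-(s * ‖ξ‖ ^ 2))) := by
        have hm : Measurable fun q : ℝ² × ℝ =>
            ENNReal.ofReal (q.2 ^ (τ / 2 - 1) * Real.exp (-q.2)) *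
            ENNReal.ofReal (powerSpectrum μ q.1 * Real.exp (-(q.2 * ‖q.1‖ ^ 2))) := by fun_prop
        rw [lintegral_const_mul _ hm.lintegral_prod_right',
          lintegral_lintegral_swap hm.aemeasurable]
        congr 1
        refine lintegral_congr fun s => ?_
        dsimp only
        rw [lintegral_const_mul _ (by fun_prop)]
    _ ≤ ENNReal.ofReal (Real.Gamma (τ / 2))⁻¹ * ∫⁻ s in Ioi (0 : ℝ),
          ENNReal.ofReal (Real.pi * (κ * (C * 4 ^ (t / 2)))) * μ univ *
            ENNReal.ofReal (Real.exp (-s) * s ^ ((τ + t) / 2 - 1 - 1)) := by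
        gcongr ENNReal.ofReal _ * ?_
        refine setLIntegral_mono' measurableSet_Ioi fun s hs => ?_
        rw [mem_Ioi] at hs
        rw [lintegral_powerSpectrum_mul_exp_norm_sq μ hs]
        calc _ ≤ ENNReal.ofReal (s ^ (τ / 2 - 1) * Real.exp (-s)) * (ENNReal.ofReal (Real.pi / s) *
              (ENNReal.ofReal (κ * (C * (4 * s) ^ (t / 2))) * μ univ)) := by
              gcongr
              exact lintegral_exp_neg_norm_sq_le hC ht hμ hs
          _ = _ := by
              rw [← mul_assoc, ← mul_assoc, ← ENNReal.ofReal_mul (by positivity),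
                ← ENNReal.ofReal_mul (by positivity), mul_right_comm _ (μ univ),
                ← ENNReal.ofReal_mul (by positivity)]
              congr 2
              rw [Real.mul_rpow (by norm_num) hs.le,
                show (τ + t) / 2 - 1 - 1 = (τ / 2 - 1) + t / 2 - 1 by ring,
                Real.rpow_sub_one hs.ne' (τ / 2 - 1 + t / 2), Real.rpow_add hs]
              ring
    _ < ∞ := by
        rw [lintegral_const_mul _ (by fun_prop)]
        have h := (Real.GammaIntegral_convergent (s := (τ + t) / 2 - 1)
            (by linarith)).lintegral_lt_top
        exact ENNReal.mul_lt_top ENNReal.ofReal_lt_top (ENNReal.mul_lt_top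
          (ENNReal.mul_lt_top ENNReal.ofReal_lt_top (measure_lt_top _ _)) h)

/-- Averaged energy estimate: `ν`-averages of anisotropic Gaussian energies of `μ` have size
`O(√a)` when the sum of the Frostman exponents exceeds `2`. -/
theorem exists_lintegral_gaussian_le {μ ν : Measure ℝ²} [IsFiniteMeasure μ] [IsFiniteMeasure ν]
    (hνS : ν (sphere 0 1)ᶜ = 0) {C C' t τ : ℝ} (hC : 0 ≤ C) (hC' : 0 ≤ C') (ht : t ≤ 2)
    (hτ0 : 0 < τ) (hτ : τ ≤ 2) (hτt : 2 < τ + t)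
    (hμ : ∀ x r, 0 < r → μ.real (ball x r) ≤ C * r ^ t)
    (hν : ∀ x r, 0 < r → ν.real (ball x r) ≤ C' * r ^ τ) :
    ∃ D : ℝ≥0∞, D ≠ ∞ ∧ ∀ a, 0 < a → ∫⁻ θ, ∫⁻ p, ENNReal.ofReal (Real.exp
        (-(⟪θ, p.1 - p.2⟫ ^ 2 / (4 * a) + ⟪rot θ, p.1 - p.2⟫ ^ 2 / 4))) ∂μ.prod μ ∂ν ≤
      ENNReal.ofReal √a * D := by
  obtain ⟨D, hD, hνD⟩ := exists_lintegral_exp_neg_inner_rot_le hνS hC' hτ0 hτ hν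
  have hfin := lintegral_powerSpectrum_mul_rpow_lt_top hC ht hμ hτ0 hτt
  have hmeas := (stronglyMeasurable_powerSpectrum μ).measurable
  refine ⟨ENNReal.ofReal Real.pi⁻¹ * (ENNReal.ofReal D *
    ∫⁻ ξ, ENNReal.ofReal (powerSpectrum μ ξ * (1 + ‖ξ‖ ^ 2) ^ (-(τ / 2)))),
    ENNReal.mul_ne_top ENNReal.ofReal_ne_top (ENNReal.mul_ne_top ENNReal.ofReal_ne_top hfin.ne),
    fun a ha => ?_⟩
  have hsph : ∀ᵐ θ ∂ν, θ ∈ sphere (0 : ℝ²) 1 := hνS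
  have hm : Measurable fun q : ℝ² × ℝ² =>
      ENNReal.ofReal (powerSpectrum μ q.2 * Real.exp (-⟪rot q.1, q.2⟫ ^ 2)) := by fun_prop
  calc _ ≤ ∫⁻ θ, ENNReal.ofReal (√a / Real.pi) *
        (∫⁻ ξ, ENNReal.ofReal (powerSpectrum μ ξ * Real.exp (-⟪rot θ, ξ⟫ ^ 2))) ∂ν := by
        refine lintegral_mono_ae ?_
        filter_upwards [hsph] with θ hθ
        exact lintegral_powerSpectrum_mul_exp_rot μ ha (mem_sphere_zero_iff_norm.1 hθ)
    _ = ENNReal.ofReal (√a / Real.pi) * ∫⁻ ξ, ∫⁻ θ,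
          ENNReal.ofReal (powerSpectrum μ ξ * Real.exp (-⟪rot θ, ξ⟫ ^ 2)) ∂ν := by
        rw [lintegral_const_mul _ hm.lintegral_prod_right',
          lintegral_lintegral_swap hm.aemeasurable]
    _ ≤ ENNReal.ofReal (√a / Real.pi) * ∫⁻ ξ, ENNReal.ofReal D *
          ENNReal.ofReal (powerSpectrum μ ξ * (1 + ‖ξ‖ ^ 2) ^ (-(τ / 2))) := by
        gcongr ENNReal.ofReal _ * ?_
        refine lintegral_mono fun ξ => ?_
        simp only [ENNReal.ofReal_mul (powerSpectrum_nonneg μ ξ)]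
        rw [lintegral_const_mul _ (by fun_prop), mul_left_comm, ← ENNReal.ofReal_mul hD]
        gcongr
        exact hνD ξ
    _ = _ := by
        rw [lintegral_const_mul _ (by fun_prop), div_eq_mul_inv,
          ENNReal.ofReal_mul (Real.sqrt_nonneg _), mul_assoc]

theorem measure_univ_le_of_ae_mem {Ω : Type*} [MeasurableSpace Ω] (m : Measure Ω)
    [IsFiniteMeasure m] {f : Ω → ℝ} (hf : Measurable f) {L : Set ℝ} (hL : ∀ᵐ x ∂m, f x ∈ L)
    {r η : ℝ} (hr : 0 < r) (hη : 0 < η) :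
    m univ ≤ ENNReal.ofReal η * (ENNReal.ofReal r⁻¹ * m.prod m {p | |f p.1 - f p.2| ≤ r}) +
      ENNReal.ofReal η⁻¹ * volume (cthickening (r / 2) L) := by
  set U := cthickening (r / 2) L
  set F : ℝ → ℝ≥0∞ := fun x => m {y | |x - f y| ≤ r / 2}
  have hvol : ∀ y : ℝ, volume {x : ℝ | |x - y| ≤ r / 2} = ENNReal.ofReal r := by
    intro y
    rw [show {x : ℝ | |x - y| ≤ r / 2} = closedBall y (r / 2) from rfl, Real.volume_closedBall]
    congr 1
    ring
  have hS : MeasurableSet {q : ℝ × Ω | |q.1 - f q.2| ≤ r / 2} :=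
    measurableSet_le (by fun_prop) measurable_const
  have hT : MeasurableSet {q : ℝ × (Ω × Ω) |
      |q.1 - f q.2.1| ≤ r / 2 ∧ |q.1 - f q.2.2| ≤ r / 2} := by
    have h1 : Measurable fun q : ℝ × (Ω × Ω) => |q.1 - f q.2.1| := by fun_prop
    have h2 : Measurable fun q : ℝ × (Ω × Ω) => |q.1 - f q.2.2| := by fun_prop
    exact (measurableSet_le h1 measurable_const).inter (measurableSet_le h2 measurable_const)
  have hG : MeasurableSet {p : Ω × Ω | |f p.1 - f p.2| ≤ r} :=
    measurableSet_le (by fun_prop) measurable_const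
  have hF1 : ∫⁻ x, F x = ENNReal.ofReal r * m univ := by
    calc ∫⁻ x, F x = volume.prod m {q : ℝ × Ω | |q.1 - f q.2| ≤ r / 2} :=
          (Measure.prod_apply hS).symm
      _ = ∫⁻ y, volume {x : ℝ | |x - f y| ≤ r / 2} ∂m := Measure.prod_apply_symm hS
      _ = _ := by simp only [hvol, lintegral_const]
  have hF2 : ∫⁻ x, F x * F x ≤ ENNReal.ofReal r * m.prod m {p | |f p.1 - f p.2| ≤ r} := by
    calc ∫⁻ x, F x * F x = ∫⁻ x, m.prod m {p | |x - f p.1| ≤ r / 2 ∧ |x - f p.2| ≤ r / 2} := by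
          refine lintegral_congr fun x => ?_
          rw [← Measure.prod_prod]
          rfl
      _ = volume.prod (m.prod m) {q : ℝ × (Ω × Ω) |
            |q.1 - f q.2.1| ≤ r / 2 ∧ |q.1 - f q.2.2| ≤ r / 2} := (Measure.prod_apply hT).symm
      _ = ∫⁻ p, volume {x : ℝ | |x - f p.1| ≤ r / 2 ∧ |x - f p.2| ≤ r / 2} ∂m.prod m :=
          Measure.prod_apply_symm hT
      _ ≤ ∫⁻ p, {p : Ω × Ω | |f p.1 - f p.2| ≤ r}.indicator
            (fun _ => ENNReal.ofReal r) p ∂m.prod m := by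
          refine lintegral_mono fun p => ?_
          by_cases hp : |f p.1 - f p.2| ≤ r
          · rw [indicator_of_mem (by exact hp), ← hvol (f p.1)]
            exact measure_mono fun x hx => hx.1
          · rw [indicator_of_notMem (by exact hp), nonpos_iff_eq_zero]
            convert measure_empty (μ := (volume : Measure ℝ))
            refine eq_empty_of_forall_notMem fun x hx => hp ?_
            have h1 := abs_le.1 hx.1
            have h2 := abs_le.1 hx.2
            exact abs_le.2 ⟨by linarith, by linarith⟩
      _ = _ := lintegral_indicator_const hG _
  set c := ENNReal.ofReal (η / r)
  have hc0 : c ≠ 0 := by simpa [c] using div_pos hη hr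
  have hct : c ≠ ∞ := ENNReal.ofReal_ne_top
  have hpt : ∀ x, F x ≤ c * (F x * F x) + U.indicator (fun _ => c⁻¹) x := by
    intro x
    by_cases hx : x ∈ U
    · rw [indicator_of_mem hx]
      rcases le_total (F x) c⁻¹ with h | h
      · exact h.trans le_add_self
      · refine le_trans ?_ le_self_add
        calc F x = c * c⁻¹ * F x := by rw [ENNReal.mul_inv_cancel hc0 hct, one_mul]
          _ ≤ c * F x * F x := by gcongr
          _ = _ := mul_assoc _ _ _
    · have : F x = 0 := by
        have hL' : m {y | f y ∉ L} = 0 := hL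
        refine measure_mono_null (s := {y | |x - f y| ≤ r / 2}) (fun y hy => ?_) hL'
        refine fun hyL => hx ?_
        exact mem_cthickening_of_dist_le x (f y) _ _ hyL hy
      rw [this]
      simp
  have hFm : Measurable F := measurable_measure_prodMk_left hS
  have key : ENNReal.ofReal r * m univ ≤
      c * (ENNReal.ofReal r * m.prod m {p | |f p.1 - f p.2| ≤ r}) + c⁻¹ * volume U := by
    calc _ = ∫⁻ x, F x := hF1.symm
      _ ≤ ∫⁻ x, (c * (F x * F x) + U.indicator (fun _ => c⁻¹) x) := lintegral_mono hpt
      _ = c * (∫⁻ x, F x * F x) + c⁻¹ * volume U := by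
          rw [lintegral_add_left (by fun_prop), lintegral_const_mul _ (by fun_prop),
            lintegral_indicator_const isClosed_cthickening.measurableSet]
      _ ≤ _ := by gcongr
  have hrr : ENNReal.ofReal r⁻¹ * ENNReal.ofReal r = 1 := by
    rw [← ENNReal.ofReal_mul (by positivity), inv_mul_cancel₀ hr.ne', ENNReal.ofReal_one]
  calc m univ = ENNReal.ofReal r⁻¹ * (ENNReal.ofReal r * m univ) := by
        rw [← mul_assoc, hrr, one_mul]
    _ ≤ ENNReal.ofReal r⁻¹ * (c * (ENNReal.ofReal r * m.prod m {p | |f p.1 - f p.2| ≤ r}) +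
        c⁻¹ * volume U) := by gcongr
    _ = _ := by
      rw [mul_add, mul_left_comm _ c, ← mul_assoc _ (ENNReal.ofReal r), hrr, one_mul,
        ← mul_assoc, ← mul_assoc]
      have h1 : ENNReal.ofReal r⁻¹ * c⁻¹ = ENNReal.ofReal η⁻¹ := by
        rw [← ENNReal.ofReal_inv_of_pos (div_pos hη hr), ← ENNReal.ofReal_mul (by positivity)]
        congr 1
        field_simp
      have h2 : c = ENNReal.ofReal η * ENNReal.ofReal r⁻¹ := by
        rw [← ENNReal.ofReal_mul hη.le, ← div_eq_mul_inv]
      rw [h1, h2]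

theorem measure_eq_zero_of_liminf_lt_top {Ω : Type*} [MeasurableSpace Ω] (m : Measure Ω)
    [IsFiniteMeasure m] {f : Ω → ℝ} (hf : Measurable f) {L : Set ℝ} (hL : ∀ᵐ x ∂m, f x ∈ L)
    (hLc : IsCompact L) (hL0 : volume L = 0) {r : ℕ → ℝ} (hr : ∀ n, 0 < r n)
    (hr0 : Tendsto r atTop (𝓝 0))
    (h : liminf (fun n => ENNReal.ofReal (r n)⁻¹ * m.prod m {p | |f p.1 - f p.2| ≤ r n})
        atTop < ∞) :
    m = 0 := by
  obtain ⟨M, hM, hMt⟩ := exists_between h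
  have hfreq := frequently_lt_of_liminf_lt (by isBoundedDefault) hM
  have hvol : Tendsto (fun n => volume (cthickening (r n / 2) L)) atTop (𝓝 0) := by
    rw [← hL0]
    refine (tendsto_measure_cthickening_of_isCompact hLc).comp ?_
    simpa using hr0.div_const 2
  have hle : ∀ η : ℝ, 0 < η → m univ ≤ ENNReal.ofReal η * M := by
    intro η hη
    have hlim : Tendsto (fun n => ENNReal.ofReal η * M +
        ENNReal.ofReal η⁻¹ * volume (cthickening (r n / 2) L)) atTop
        (𝓝 (ENNReal.ofReal η * M + ENNReal.ofReal η⁻¹ * 0)) :=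
      tendsto_const_nhds.add (ENNReal.Tendsto.const_mul hvol (Or.inr ENNReal.ofReal_ne_top))
    rw [mul_zero, add_zero] at hlim
    refine ge_of_tendsto_of_frequently hlim (hfreq.mono fun n hn => ?_)
    refine (measure_univ_le_of_ae_mem m hf hL (hr n) hη).trans ?_
    gcongr
  rw [← Measure.measure_univ_eq_zero, ← nonpos_iff_eq_zero]
  have hlim : Tendsto (fun n => ENNReal.ofReal (r n) * M) atTop (𝓝 (ENNReal.ofReal 0 * M)) :=
    ENNReal.Tendsto.mul_const (ENNReal.tendsto_ofReal hr0) (Or.inr hMt.ne)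
  rw [ENNReal.ofReal_zero, zero_mul] at hlim
  exact ge_of_tendsto' hlim fun n => hle _ (hr n)

theorem measurableSet_volume_image_inner_eq_zero {K : Set ℝ²} (hK : IsCompact K) :
    MeasurableSet {θ : ℝ² | volume ((fun x => ⟪θ, x⟫) '' K) = 0} := by
  have hopen : ∀ ε : ℝ≥0∞, IsOpen {θ : ℝ² | volume ((fun x => ⟪θ, x⟫) '' K) < ε} := by
    intro ε
    obtain ⟨R, hR0, hR⟩ := hK.isBounded.exists_pos_norm_le
    refine isOpen_iff_mem_nhds.2 fun θ hθ => ?_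
    have hc : IsCompact ((fun x => ⟪θ, x⟫) '' K) := hK.image (by fun_prop)
    have hev := (tendsto_measure_cthickening_of_isCompact (μ := volume) hc).eventually_lt_const hθ
    obtain ⟨δ, hδ, hball⟩ := Metric.eventually_nhds_iff_ball.1 hev
    have hδ2 := hball (δ / 2) (by
      rw [mem_ball, Real.dist_0_eq_abs, abs_of_pos (half_pos hδ)]; linarith)
    filter_upwards [ball_mem_nhds θ (show 0 < δ / 2 / R by positivity)] with θ' hθ'
    refine lt_of_le_of_lt (measure_mono ?_) hδ2
    rintro _ ⟨x, hx, rfl⟩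
    refine mem_cthickening_of_dist_le _ ⟪θ, x⟫ _ _ (mem_image_of_mem _ hx) ?_
    rw [Real.dist_eq, ← inner_sub_left]
    calc |⟪θ' - θ, x⟫| ≤ ‖θ' - θ‖ * ‖x‖ := abs_real_inner_le_norm _ _
      _ ≤ (δ / 2 / R) * R := by
          gcongr
          · rw [← dist_eq_norm]; exact (mem_ball.1 hθ').le
          · exact hR x hx
      _ = δ / 2 := by field_simp
  have : {θ : ℝ² | volume ((fun x => ⟪θ, x⟫) '' K) = 0} =
      ⋂ n : ℕ, {θ : ℝ² | volume ((fun x => ⟪θ, x⟫) '' K) < (n + 1 : ℝ≥0∞)⁻¹} := by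
    ext θ
    simp only [mem_iInter, Set.mem_ofPred_eq]
    refine ⟨fun h n => by simp [h], fun h => ?_⟩
    by_contra h0
    obtain ⟨n, hn⟩ := ENNReal.exists_inv_nat_lt h0
    refine absurd (h n) (not_lt.2 (le_trans ?_ hn.le))
    exact ENNReal.inv_le_inv.2 le_self_add
  rw [this]
  exact MeasurableSet.iInter fun n => (hopen _).measurableSet

theorem ae_liminf_lt_top {μ ν : Measure ℝ²} [IsFiniteMeasure μ] [IsFiniteMeasure ν]
    {K : Set ℝ²} (hK : IsCompact K) (hμK : μ Kᶜ = 0)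
    (hνS : ν (sphere 0 1)ᶜ = 0) {C C' t τ : ℝ} (hC : 0 ≤ C) (hC' : 0 ≤ C') (ht : t ≤ 2)
    (hτ0 : 0 < τ) (hτ : τ ≤ 2) (hτt : 2 < τ + t)
    (hμ : ∀ x r, 0 < r → μ.real (ball x r) ≤ C * r ^ t)
    (hν : ∀ x r, 0 < r → ν.real (ball x r) ≤ C' * r ^ τ) {r : ℕ → ℝ} (hr : ∀ n, 0 < r n) :
    ∀ᵐ θ ∂ν, liminf (fun n => ENNReal.ofReal (r n)⁻¹ *
      μ.prod μ {p | |⟪θ, p.1⟫ - ⟪θ, p.2⟫| ≤ r n}) atTop < ∞ := by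
  obtain ⟨D, hD, hDle⟩ := exists_lintegral_gaussian_le hνS hC hC' ht hτ0 hτ hτt hμ hν
  obtain ⟨R, hR0, hR⟩ := hK.isBounded.exists_pos_norm_le
  set f : ℕ → ℝ² → ℝ≥0∞ := fun n θ => ENNReal.ofReal (r n)⁻¹ *
    ∫⁻ p, ENNReal.ofReal (Real.exp
        (-(⟪θ, p.1 - p.2⟫ ^ 2 / (r n) ^ 2 + ⟪rot θ, p.1 - p.2⟫ ^ 2 / 4))) ∂μ.prod μ
  have hfm : ∀ n, Measurable (f n) := by
    intro n
    have hm : Measurable fun q : ℝ² × (ℝ² × ℝ²) => ENNReal.ofReal (Real.exp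
        (-(⟪q.1, q.2.1 - q.2.2⟫ ^ 2 / (r n) ^ 2 + ⟪rot q.1, q.2.1 - q.2.2⟫ ^ 2 / 4))) := by
      fun_prop
    exact hm.lintegral_prod_right'.const_mul _
  have hfint : ∀ n, ∫⁻ θ, f n θ ∂ν ≤ D := by
    intro n
    rw [lintegral_const_mul']
    swap
    · exact ENNReal.ofReal_ne_top
    have h := hDle (r n ^ 2 / 4) (by have := hr n; positivity)
    rw [mul_div_cancel₀ _ (by norm_num : (4 : ℝ) ≠ 0)] at h
    calc _ ≤ ENNReal.ofReal (r n)⁻¹ * (ENNReal.ofReal √(r n ^ 2 / 4) * D) := by gcongr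
      _ = ENNReal.ofReal ((r n)⁻¹ * √(r n ^ 2 / 4)) * D := by
          rw [← mul_assoc, ENNReal.ofReal_mul (inv_nonneg.2 (hr n).le)]
      _ ≤ 1 * D := by
          gcongr
          rw [ENNReal.ofReal_le_one, Real.sqrt_div (sq_nonneg _), Real.sqrt_sq (hr n).le,
            mul_div_assoc', inv_mul_cancel₀ (hr n).ne', div_le_one (by positivity)]
          exact Real.le_sqrt_of_sq_le (by norm_num)
      _ = D := one_mul _
  have hlim : ∫⁻ θ, liminf (fun n => f n θ) atTop ∂ν ≠ ∞ := by
    refine ne_top_of_le_ne_top hD ((lintegral_liminf_le hfm).trans ?_)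
    exact liminf_le_of_le (by isBoundedDefault) fun b hb => by
      obtain ⟨n, hn⟩ := hb.exists
      exact hn.trans (hfint n)
  filter_upwards [ae_lt_top (Measurable.liminf hfm) hlim, hνS] with θ hθ hθS
  rw [mem_sphere_zero_iff_norm] at hθS
  have hKae : ∀ᵐ x ∂μ, x ∈ K := hμK
  have hKK : ∀ᵐ p ∂μ.prod μ, p.1 ∈ K ∧ p.2 ∈ K :=
    (Measure.quasiMeasurePreserving_fst.ae hKae).and (Measure.quasiMeasurePreserving_snd.ae hKae)
  set M := ENNReal.ofReal (Real.exp (1 + R ^ 2))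
  have hle : ∀ n, ENNReal.ofReal (r n)⁻¹ * μ.prod μ {p | |⟪θ, p.1⟫ - ⟪θ, p.2⟫| ≤ r n} ≤
      M * f n θ := by
    intro n
    simp only [f]
    rw [mul_left_comm]
    gcongr
    rw [← lintegral_const_mul _ (by fun_prop), ← lintegral_indicator_one
      (measurableSet_le (by fun_prop) measurable_const)]
    refine lintegral_mono_ae ?_
    filter_upwards [hKK] with p hp
    by_cases hpr : |⟪θ, p.1⟫ - ⟪θ, p.2⟫| ≤ r n
    · rw [indicator_of_mem (by exact hpr), ← ENNReal.ofReal_mul (Real.exp_pos _).le,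
        ← Real.exp_add, Pi.one_apply, ENNReal.one_le_ofReal, Real.one_le_exp_iff]
      have h1 : ⟪θ, p.1 - p.2⟫ ^ 2 / r n ^ 2 ≤ 1 := by
        rw [inner_sub_right, div_le_one (by have := hr n; positivity), ← sq_abs]
        gcongr
      have h2 : ⟪rot θ, p.1 - p.2⟫ ^ 2 ≤ (2 * R) ^ 2 := by
        rw [← sq_abs]
        gcongr
        calc |⟪rot θ, p.1 - p.2⟫| ≤ ‖rot θ‖ * ‖p.1 - p.2‖ := abs_real_inner_le_norm _ _
          _ = ‖p.1 - p.2‖ := by rw [norm_rot, hθS, one_mul]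
          _ ≤ ‖p.1‖ + ‖p.2‖ := norm_sub_le _ _
          _ ≤ 2 * R := by linarith [hR _ hp.1, hR _ hp.2]
      nlinarith
    · rw [indicator_of_notMem (by exact hpr)]
      exact zero_le
  calc _ ≤ liminf (fun n => M * f n θ) atTop := liminf_le_liminf (Eventually.of_forall hle)
    _ = M * liminf (fun n => f n θ) atTop :=
      ENNReal.liminf_const_mul_of_ne_top ENNReal.ofReal_ne_top
    _ < ∞ := ENNReal.mul_lt_top ENNReal.ofReal_lt_top hθ

/-- Falconer's bound on the dimension of the set of exceptional directions for the orthogonal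
projections of a planar set of dimension greater than one. -/
theorem dimH_volume_image_inner_eq_zero_le {A : Set ℝ²} (hA : MeasurableSet A)
    (hdim : 1 < dimH A) :
    dimH {θ ∈ sphere (0 : ℝ²) 1 | volume ((fun x => ⟪θ, x⟫) '' A) = 0} ≤ 2 - dimH A := by
  have hle2 : ∀ S : Set ℝ², dimH S ≤ 2 := fun S => by
    refine (dimH_mono (subset_univ S)).trans_eq ?_
    rw [Real.dimH_univ_eq_finrank]
    simp
  have hfin : ∀ S : Set ℝ², dimH S ≠ ∞ := fun S => ne_top_of_le_ne_top (by simp) (hle2 S)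
  set E := {θ ∈ sphere (0 : ℝ²) 1 | volume ((fun x => ⟪θ, x⟫) '' A) = 0}
  by_contra hcon
  have hsum : (2 : ℝ≥0∞) < dimH E + dimH A := by
    by_contra h
    exact hcon (ENNReal.le_sub_of_add_le_right (hfin A) (not_lt.1 h))
  have hA2 := ENNReal.toReal_mono (by simp) (hle2 A)
  have hE2 := ENNReal.toReal_mono (by simp) (hle2 E)
  have hA1 := (ENNReal.toReal_lt_toReal (by simp) (hfin A)).2 hdim
  have hs := (ENNReal.toReal_lt_toReal (by simp) (by simp [hfin])).2 hsum
  rw [ENNReal.toReal_add (hfin _) (hfin _)] at hs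
  simp only [ENNReal.toReal_ofNat, ENNReal.toReal_one] at hA2 hE2 hA1 hs
  set a := (dimH A).toReal with ha
  set e := (dimH E).toReal with he
  set k := (a + e - 2) / 4 with hk
  obtain ⟨K, hKA, hK, μ, hμf, hμ0, hμK, C, hC, hμ⟩ :=
    exists_frostman_measure hA (t := a - k) (by linarith) (by
      rw [← ENNReal.ofReal_toReal (hfin A), ENNReal.ofReal_lt_ofReal_iff] <;> linarith)
  set E' := sphere (0 : ℝ²) 1 ∩ {θ | volume ((fun x => ⟪θ, x⟫) '' K) = 0}
  have hEE' : E ⊆ E' := fun θ hθ => ⟨hθ.1, measure_mono_null (image_mono hKA) hθ.2⟩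
  have hE'm : MeasurableSet E' :=
    isClosed_sphere.measurableSet.inter (measurableSet_volume_image_inner_eq_zero hK)
  obtain ⟨K', hK'E, hK', ν, hνf, hν0, hνK, C', hC', hν⟩ :=
    exists_frostman_measure hE'm (t := e - k) (by linarith) (by
      refine lt_of_lt_of_le ?_ (dimH_mono hEE')
      rw [← ENNReal.ofReal_toReal (hfin E), ENNReal.ofReal_lt_ofReal_iff] <;> linarith)
  have hνS : ν (sphere 0 1)ᶜ = 0 :=
    measure_mono_null (compl_subset_compl.2 (hK'E.trans inter_subset_left)) hνK
  have hae := ae_liminf_lt_top hK hμK hνS hC hC' (by linarith) (by linarith) (by linarith)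
    (by linarith) hμ hν (r := fun n => 1 / ((n : ℝ) + 1)) (fun n => by positivity)
  have hK'ae : ∀ᵐ θ ∂ν, θ ∈ K' := hνK
  have : NeBot (ae ν) := ae_neBot.2 hν0
  obtain ⟨θ, hθ, hθK'⟩ := (hae.and hK'ae).exists
  have hKae : ∀ᵐ x ∂μ, x ∈ K := hμK
  refine hμ0 (measure_eq_zero_of_liminf_lt_top μ (f := fun x => ⟪θ, x⟫) (by fun_prop)
    (hKae.mono fun x hx => mem_image_of_mem _ hx) (hK.image (by fun_prop)) (hK'E hθK').2
    (fun n => by positivity) tendsto_one_div_add_atTop_nhds_zero_nat hθ)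

end GaussianEnergy

namespace NormProjection

open Filter Topology EuclideanPlane
open scoped NNReal

local notation "ℝ²" => EuclideanSpace ℝ (Fin 2)

/-- The point `w` minimizes `N` on the line through `w` perpendicular to `v`. -/
def IsMinPerp (N : ℝ² → ℝ) (v w : ℝ²) : Prop :=
  ∀ h, ⟪v, h⟫ = 0 → N w ≤ N (w + h)

section Norm

variable {N : ℝ² → ℝ}

theorem map_zero_of_smul (hN_smul : ∀ (c : ℝ) x, N (c • x) = |c| * N x) : N 0 = 0 := by
  simpa using hN_smul 0 0

theorem pos_of_ne_zero (hN_add : ∀ x y, N (x + y) ≤ N x + N y)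
    (hN_smul : ∀ (c : ℝ) x, N (c • x) = |c| * N x) (hN_zero : ∀ x, N x = 0 → x = 0)
    {x : ℝ²} (hx : x ≠ 0) : 0 < N x := by
  have h1 := hN_add x ((-1 : ℝ) • x)
  rw [hN_smul, neg_one_smul, add_neg_cancel, map_zero_of_smul hN_smul, abs_neg, abs_one] at h1
  exact lt_of_le_of_ne (by linarith) fun h => hx (hN_zero x h.symm)

theorem IsMinPerp.smul (hN_smul : ∀ (c : ℝ) x, N (c • x) = |c| * N x) {v w : ℝ²}
    (h : IsMinPerp N v w) {c : ℝ} (hc : c ≠ 0) : IsMinPerp N v (c • w) := by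
  intro k hk
  have h1 := h (c⁻¹ • k) (by rw [inner_smul_right, hk, mul_zero])
  rw [show c • w + k = c • (w + c⁻¹ • k) by rw [smul_add, smul_inv_smul₀ hc], hN_smul, hN_smul]
  gcongr

theorem fderiv_apply_self (hN_smul : ∀ (c : ℝ) x, N (c • x) = |c| * N x) {w : ℝ²}
    (hd : DifferentiableAt ℝ N w) : fderiv ℝ N w w = N w := by
  have h1 : HasDerivAt (fun t : ℝ => N (t • w)) (fderiv ℝ N w w) 1 := by
    have hl : HasDerivAt (fun t : ℝ => t • w) w 1 := by
      simpa using (hasDerivAt_id (1 : ℝ)).smul_const w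
    have hd' : HasFDerivAt N (fderiv ℝ N w) ((1 : ℝ) • w) := by
      rw [one_smul]; exact hd.hasFDerivAt
    exact hd'.comp_hasDerivAt 1 hl
  have h2 : HasDerivAt (fun t : ℝ => N (t • w)) (N w) 1 := by
    have h3 : HasDerivAt (fun t : ℝ => t * N w) (N w) 1 := by
      simpa using (hasDerivAt_id (1 : ℝ)).mul_const (N w)
    refine h3.congr_of_eventuallyEq ?_
    filter_upwards [lt_mem_nhds (one_pos : (0 : ℝ) < 1)] with t ht
    rw [hN_smul, abs_of_pos ht]
  exact h1.unique h2

theorem IsMinPerp.fderiv_apply_eq_zero {v w h : ℝ²} (hw : IsMinPerp N v w)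
    (hd : DifferentiableAt ℝ N w) (hh : ⟪v, h⟫ = 0) : fderiv ℝ N w h = 0 := by
  have h1 : HasDerivAt (fun t : ℝ => N (w + t • h)) (fderiv ℝ N w h) 0 := by
    have hl : HasDerivAt (fun t : ℝ => w + t • h) h 0 := by
      simpa using ((hasDerivAt_id (0 : ℝ)).smul_const h).const_add w
    have hd' : HasFDerivAt N (fderiv ℝ N w) (w + (0 : ℝ) • h) := by
      rw [zero_smul, add_zero]; exact hd.hasFDerivAt
    exact hd'.comp_hasDerivAt 0 hl
  refine IsLocalMin.hasDerivAt_eq_zero (Eventually.of_forall fun t => ?_) h1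
  simpa using hw (t • h) (by rw [inner_smul_right, hh, mul_zero])

/-- The Euclidean gradient in coordinates. -/
def grad (N : ℝ² → ℝ) (x : ℝ²) : ℝ² :=
  ∑ i, fderiv ℝ N x (EuclideanSpace.basisFun (Fin 2) ℝ i) • EuclideanSpace.basisFun (Fin 2) ℝ i

theorem inner_grad (x h : ℝ²) : ⟪grad N x, h⟫ = fderiv ℝ N x h := by
  conv_rhs => rw [← (EuclideanSpace.basisFun (Fin 2) ℝ).sum_repr' h]
  rw [grad, sum_inner, map_sum]
  refine Finset.sum_congr rfl fun i _ => ?_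
  rw [real_inner_smul_left, map_smul, smul_eq_mul, mul_comm]

theorem contDiffAt_grad {x : ℝ²} (h : ContDiffAt ℝ 2 N x) : ContDiffAt ℝ 1 (grad N) x := by
  have h1 : ContDiffAt ℝ 1 (fderiv ℝ N) x := h.fderiv_right (by norm_num)
  exact ContDiffAt.sum fun i _ => (h1.clm_apply contDiffAt_const).smul contDiffAt_const

theorem eq_inner_smul_add {v : ℝ²} (hv : ‖v‖ = 1) (x : ℝ²) :
    x = ⟪v, x⟫ • v + ⟪rot v, x⟫ • rot v := by
  have h := norm_sq_eq v
  rw [hv] at h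
  ext i
  fin_cases i
  · simp only [inner_eq, PiLp.add_apply, PiLp.smul_apply, smul_eq_mul, rot_apply_zero,
      rot_apply_one, Fin.zero_eta]
    linear_combination (x 0) * h
  · simp only [inner_eq, PiLp.add_apply, PiLp.smul_apply, smul_eq_mul, rot_apply_zero,
      rot_apply_one, Fin.mk_one]
    linear_combination (x 1) * h

theorem eq_smul_rot {v x : ℝ²} (hv : ‖v‖ = 1) (h : ⟪v, x⟫ = 0) : x = ⟪rot v, x⟫ • rot v := by
  conv_lhs => rw [eq_inner_smul_add hv x, h, zero_smul, zero_add]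

theorem IsMinPerp.eq_grad {v w : ℝ²} (hN_smul : ∀ (c : ℝ) x, N (c • x) = |c| * N x)
    (hw : IsMinPerp N v w) (hv : ‖v‖ = 1) (hd : DifferentiableAt ℝ N w) (hvw : 0 < ⟪v, w⟫)
    (hNw : 0 < N w) : grad N w ≠ 0 ∧ v = ‖grad N w‖⁻¹ • grad N w := by
  have h1 : grad N w = ⟪v, grad N w⟫ • v := by
    have h0 : ⟪rot v, grad N w⟫ = 0 := by
      rw [real_inner_comm, inner_grad]
      exact hw.fderiv_apply_eq_zero hd (by rw [real_inner_comm, inner_rot_self])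
    conv_lhs => rw [eq_inner_smul_add hv (grad N w), h0, zero_smul, add_zero]
  set c := ⟪v, grad N w⟫
  have h2 : c * ⟪v, w⟫ = N w := by
    rw [← fderiv_apply_self hN_smul hd, ← inner_grad, h1, real_inner_smul_left]
  have hc : 0 < c := by
    by_contra hc
    nlinarith [mul_nonneg (neg_nonneg.2 (not_lt.1 hc)) hvw.le]
  have hn : ‖grad N w‖ = c := by rw [h1, norm_smul, hv, mul_one, Real.norm_of_nonneg hc.le]
  refine ⟨fun h => hc.ne' (by rw [← hn, h, norm_zero]), ?_⟩
  rw [hn]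
  conv_rhs => rw [h1]
  rw [inv_smul_smul₀ hc.ne']

end Norm

theorem deriv_deriv_eq_zero_of_inner {γ : ℝ → ℝ²} (hγ_C2 : ContDiff ℝ 2 γ)
    (hγ_unit : ∀ t, ‖deriv γ t‖ = 1) {v : ℝ²} (hv : ‖v‖ = 1) {t₀ : ℝ}
    (h : ∀ᶠ t in 𝓝 t₀, ⟪v, deriv γ t⟫ = 0) : deriv (deriv γ) t₀ = 0 := by
  have hd : DifferentiableAt ℝ (deriv γ) t₀ := by
    have : ContDiff ℝ 1 (deriv γ) := ContDiff.deriv' (n := 1) hγ_C2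
    exact (this.differentiable (by norm_num)) t₀
  have h1 : ⟪v, deriv (deriv γ) t₀⟫ = 0 := by
    have := ((hasDerivAt_const t₀ v).inner ℝ hd.hasDerivAt).congr_of_eventuallyEq
      (f₁ := fun _ => (0 : ℝ)) (h.mono fun t ht => ht.symm)
    have h0 := this.unique (hasDerivAt_const t₀ (0 : ℝ))
    simpa using h0
  have h2 : ⟪deriv γ t₀, deriv (deriv γ) t₀⟫ = 0 := by
    have := (hd.hasDerivAt.inner ℝ hd.hasDerivAt).congr_of_eventuallyEq
      (f₁ := fun _ => (1 : ℝ)) (Eventually.of_forall fun t => by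
        simp [hγ_unit])
    have h0 := this.unique (hasDerivAt_const t₀ (1 : ℝ))
    rw [real_inner_comm (deriv γ t₀)] at h0
    linarith
  have h3 := eq_smul_rot hv h.self_of_nhds
  have h4 := eq_smul_rot hv h1
  have hk : ⟪rot v, deriv γ t₀⟫ ≠ 0 := fun hk => by
    rw [hk, zero_smul] at h3
    have := hγ_unit t₀
    rw [h3, norm_zero] at this
    exact zero_ne_one this
  rw [h3, real_inner_smul_left] at h2
  rw [h4, (mul_eq_zero.1 h2).resolve_left hk, zero_smul]

/-- On a line missing the origin the norm has at most one minimizer, because the unit circle has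
nonvanishing curvature. -/
theorem IsMinPerp.eq_of_inner_eq {N : ℝ² → ℝ} (hN_add : ∀ x y, N (x + y) ≤ N x + N y)
    (hN_smul : ∀ (c : ℝ) x, N (c • x) = |c| * N x) (hN_zero : ∀ x, N x = 0 → x = 0)
    {γ : ℝ → ℝ²} (hγ_C2 : ContDiff ℝ 2 γ) (hγ_range : range γ = {x | N x = 1})
    (hγ_unit : ∀ t, ‖deriv γ t‖ = 1) (hγ_curv : ∀ t, deriv (deriv γ) t ≠ 0)
    {v w₁ w₂ : ℝ²} (hv : ‖v‖ = 1) (h₁ : IsMinPerp N v w₁) (h₂ : IsMinPerp N v w₂)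
    (h0 : ⟪v, w₁⟫ ≠ 0) (h12 : ⟪v, w₁⟫ = ⟪v, w₂⟫) : w₁ = w₂ := by
  by_contra hne
  set d := w₂ - w₁
  have hd0 : d ≠ 0 := sub_ne_zero.2 (Ne.symm hne)
  have hvd : ⟪v, d⟫ = 0 := by rw [inner_sub_right, h12, sub_self]
  set c := ⟪v, w₁⟫ with hc
  set m := N w₁ with hm
  have hw₁ : w₁ ≠ 0 := fun h => h0 (by rw [hc, h, inner_zero_right])
  have hm0 : 0 < m := pos_of_ne_zero hN_add hN_smul hN_zero hw₁
  have hw₂ : N w₂ ≤ m := by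
    have := h₂ (-d) (by rw [inner_neg_right, hvd, neg_zero])
    rwa [show w₂ + -d = w₁ by simp [d]] at this
  have hseg : ∀ s : ℝ, 0 < s → s < 1 → N (w₁ + s • d) = m := by
    intro s hs0 hs1
    refine le_antisymm ?_ (h₁ _ (by rw [inner_smul_right, hvd, mul_zero]))
    have := hN_add ((1 - s) • w₁) (s • w₂)
    rw [hN_smul, hN_smul, abs_of_pos hs0, abs_of_pos (sub_pos.2 hs1)] at this
    rw [show w₁ + s • d = (1 - s) • w₁ + s • w₂ by simp only [d]; module]
    nlinarith
  have hrd : ⟪rot v, d⟫ ≠ 0 := fun h => hd0 (by rw [eq_smul_rot hv hvd, h, zero_smul])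
  have hmid := hseg (1 / 2) (by norm_num) (by norm_num)
  obtain ⟨t₀, ht₀⟩ : m⁻¹ • (w₁ + (1 / 2 : ℝ) • d) ∈ range γ := by
    rw [hγ_range, Set.mem_ofPred_eq, hN_smul, hmid, abs_of_pos (inv_pos.2 hm0),
      inv_mul_cancel₀ hm0.ne']
  have hvt₀ : ⟪v, γ t₀⟫ = m⁻¹ * c := by
    rw [ht₀, inner_smul_right, inner_add_right, inner_smul_right, hvd, mul_zero, add_zero]
  have hvt₀' : ⟪v, γ t₀⟫ ≠ 0 := by
    rw [hvt₀]; exact mul_ne_zero (inv_ne_zero hm0.ne') h0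
  have hγc : Continuous γ := hγ_C2.continuous
  have hne0 : ∀ᶠ t in 𝓝 t₀, ⟪v, γ t⟫ ≠ 0 :=
    (continuous_const.inner hγc).continuousAt.eventually_ne hvt₀'
  set σ : ℝ → ℝ := fun t => ⟪rot v, (c / ⟪v, γ t⟫) • γ t - w₁⟫ / ⟪rot v, d⟫ with hσ
  have hσt₀ : σ t₀ = 1 / 2 := by
    have : (c / ⟪v, γ t₀⟫) • γ t₀ - w₁ = (1 / 2 : ℝ) • d := by
      rw [hvt₀, ht₀, smul_smul, show c / (m⁻¹ * c) * m⁻¹ = 1 by field_simp, one_smul,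
        add_sub_cancel_left]
    rw [hσ]
    dsimp only
    rw [this, inner_smul_right, mul_div_cancel_right₀ _ hrd]
  have hσc : ContinuousAt σ t₀ := by
    have h1 : ContinuousAt (fun t => ⟪v, γ t⟫) t₀ := (continuous_const.inner hγc).continuousAt
    have h2 : ContinuousAt (fun t => (c / ⟪v, γ t⟫) • γ t - w₁) t₀ :=
      ((continuousAt_const.div h1 hvt₀').smul hγc.continuousAt).sub continuousAt_const
    exact (continuousAt_const.inner (𝕜 := ℝ) h2).div_const _
  have hσ0 : ∀ᶠ t in 𝓝 t₀, 0 < σ t := hσc.eventually_const_lt (by rw [hσt₀]; norm_num)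
  have hσ1 : ∀ᶠ t in 𝓝 t₀, σ t < 1 := hσc.eventually_lt_const (by rw [hσt₀]; norm_num)
  have hconst : ∀ᶠ t in 𝓝 t₀, ⟪v, γ t⟫ ^ 2 = (c / m) ^ 2 := by
    filter_upwards [hne0, hσ0, hσ1] with t ht h0t h1t
    have hperp : ⟪v, (c / ⟪v, γ t⟫) • γ t - w₁⟫ = 0 := by
      rw [inner_sub_right, inner_smul_right, div_mul_cancel₀ _ ht, ← hc, sub_self]
    have hx : (c / ⟪v, γ t⟫) • γ t = w₁ + σ t • d := by
      rw [← sub_eq_iff_eq_add', eq_smul_rot hv hperp]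
      conv_rhs => rw [eq_smul_rot hv hvd]
      rw [smul_smul, hσ]
      dsimp only
      rw [div_mul_cancel₀ _ hrd]
    have hN1 : N (γ t) = 1 := by
      have : γ t ∈ range γ := mem_range_self t
      rwa [hγ_range] at this
    have := congrArg N hx
    rw [hseg _ h0t h1t, hN_smul, hN1, mul_one] at this
    rw [← this, div_pow, sq_abs, div_pow]
    field_simp
  refine hγ_curv t₀ (deriv_deriv_eq_zero_of_inner hγ_C2 hγ_unit hv ?_)
  filter_upwards [hconst.eventually_nhds, hne0] with t ht ht0
  have hdγ : HasDerivAt γ (deriv γ t) t :=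
    ((hγ_C2.differentiable (by norm_num)) t).hasDerivAt
  have h3 := (((hasDerivAt_const t v).inner ℝ hdγ).pow 2).congr_of_eventuallyEq
      (f₁ := fun _ => (c / m) ^ 2) (ht.mono fun t ht => ht.symm)
  have h4 := h3.unique (hasDerivAt_const t _)
  simpa [ht0] using h4

/-- The unit normal of the `N`-sphere at the point obtained by rotating `θ` clockwise. -/
def normal (N : ℝ² → ℝ) (θ : ℝ²) : ℝ² :=
  ‖grad N (-rot θ)‖⁻¹ • grad N (-rot θ)

theorem dimH_image_normal_le {N : ℝ² → ℝ} (hN_add : ∀ x y, N (x + y) ≤ N x + N y)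
    (hN_smul : ∀ (c : ℝ) x, N (c • x) = |c| * N x) (hN_zero : ∀ x, N x = 0 → x = 0)
    (hN_C2 : ContDiffOn ℝ 2 N ({0}ᶜ : Set ℝ²)) {E : Set ℝ²} (hE : E ⊆ sphere 0 1) :
    dimH (normal N '' E) ≤ dimH E := by
  refine dimH_image_le_of_locally_lipschitzOn fun θ hθ => ?_
  have hθ1 := mem_sphere_zero_iff_norm.1 (hE hθ)
  have hw : -rot θ ≠ 0 := by
    rw [← norm_ne_zero_iff, norm_neg, norm_rot, hθ1]
    exact one_ne_zero
  have hN : ContDiffAt ℝ 2 N (-rot θ) := hN_C2.contDiffAt (isOpen_compl_singleton.mem_nhds hw)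
  have hg0 : grad N (-rot θ) ≠ 0 := fun h => by
    have h1 := inner_grad (N := N) (-rot θ) (-rot θ)
    rw [h, inner_zero_left, fderiv_apply_self hN_smul (hN.differentiableAt (by norm_num))] at h1
    exact (pos_of_ne_zero hN_add hN_smul hN_zero hw).ne h1
  have hg : ContDiffAt ℝ 1 (fun θ => grad N (-rot θ)) θ :=
    ContDiffAt.comp (g := grad N) (f := fun θ => -rot θ) θ (contDiffAt_grad hN)
      rot.contDiff.neg.contDiffAt
  have hn : ContDiffAt ℝ 1 (normal N) θ :=
    ((hg.norm ℝ hg0).inv (norm_ne_zero_iff.2 hg0)).smul hg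
  obtain ⟨C, t, ht, hC⟩ := hn.exists_lipschitzOnWith
  exact ⟨C, t, mem_nhdsWithin_of_mem_nhds ht, hC⟩

theorem volume_image_inner_eq_zero {P : ℝ² → ℝ²} {A : Set ℝ²} {θ : ℝ²} (hθ : ‖θ‖ = 1)
    (hP : ∀ x, ⟪θ, P x⟫ = ⟪θ, x⟫) (h : (μH[1] : Measure ℝ²) (P '' A) = 0) :
    volume ((fun x => ⟪θ, x⟫) '' A) = 0 := by
  have himg : (fun x => ⟪θ, x⟫) '' A = (fun x => ⟪θ, x⟫) '' (P '' A) := by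
    rw [image_image]
    simp only [hP]
  have hL : LipschitzWith 1 fun x : ℝ² => ⟪θ, x⟫ := by
    refine LipschitzWith.of_dist_le_mul fun x y => ?_
    rw [Real.dist_eq, dist_eq_norm, ← inner_sub_right, NNReal.coe_one]
    simpa [hθ] using abs_real_inner_le_norm θ (x - y)
  rw [himg, ← hausdorffMeasure_real, ← nonpos_iff_eq_zero]
  refine ((hL.lipschitzOnWith (s := P '' A)).hausdorffMeasure_image_le zero_le_one).trans_eq ?_
  rw [h, mul_zero]

end NormProjection

/-- for `s := dim A > 1`, the set of exceptional directions `v ∈ S¹`,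
i.e. those with `ℋ¹(P_v(A)) = 0`, has Hausdorff dimension at most `2 - min s (1+δ)`. -/
theorem marstrand_projection_exceptional_set
    (N : EuclideanSpace ℝ (Fin 2) → ℝ)
    (hN_add : ∀ x y : EuclideanSpace ℝ (Fin 2), N (x + y) ≤ N x + N y)
    (hN_smul : ∀ (c : ℝ) (x : EuclideanSpace ℝ (Fin 2)), N (c • x) = |c| * N x)
    (hN_zero : ∀ x : EuclideanSpace ℝ (Fin 2), N x = 0 → x = 0)
    -- `N` restricted to `ℝ² \ {0}` is of class `C^{2,δ}` for some `δ ∈ (0,1)`: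
    (δ : ℝ) (hδ0 : 0 < δ) (hδ1 : δ < 1)
    (hN_C2 : ContDiffOn ℝ 2 N ({0}ᶜ : Set (EuclideanSpace ℝ (Fin 2))))
    (hN_holder : ∀ K : Set (EuclideanSpace ℝ (Fin 2)), K ⊆ {0}ᶜ → IsCompact K →
      ∃ M : ℝ, ∀ x ∈ K, ∀ y ∈ K,
        ‖iteratedFDerivWithin ℝ 2 N ({0}ᶜ : Set (EuclideanSpace ℝ (Fin 2))) x -
          iteratedFDerivWithin ℝ 2 N ({0}ᶜ : Set (EuclideanSpace ℝ (Fin 2))) y‖ ≤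
            M * ‖x - y‖ ^ δ)
    -- the N-unit circle has an arc-length parametrization with everywhere
    -- nonvanishing second derivative (strictly positive curvature):
    (γ : ℝ → EuclideanSpace ℝ (Fin 2)) (L : ℝ) (hL : 0 < L)
    (hγ_C2 : ContDiff ℝ 2 γ)
    (hγ_per : ∀ t, γ (t + L) = γ t)
    (hγ_range : Set.range γ = {x : EuclideanSpace ℝ (Fin 2) | N x = 1})
    (hγ_unit : ∀ t, ‖deriv γ t‖ = 1)
    (hγ_curv : ∀ t, deriv (deriv γ) t ≠ 0)
    -- `P v` is the closest-point projection (w.r.t. `N`) onto the line `H_v`: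
    (P : EuclideanSpace ℝ (Fin 2) → EuclideanSpace ℝ (Fin 2) → EuclideanSpace ℝ (Fin 2))
    (hP : ∀ v ∈ sphere (0 : EuclideanSpace ℝ (Fin 2)) 1, ∀ x : EuclideanSpace ℝ (Fin 2),
      ⟪v, P v x⟫ = 0 ∧
        ∀ q : EuclideanSpace ℝ (Fin 2), ⟪v, q⟫ = 0 → N (x - P v x) ≤ N (x - q))
    (A : Set (EuclideanSpace ℝ (Fin 2))) (hA : MeasurableSet A)
    (hdimA : 1 < dimH A) :
    dimH {v ∈ sphere (0 : EuclideanSpace ℝ (Fin 2)) 1 |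
        (μH[1] : Measure (EuclideanSpace ℝ (Fin 2))) (P v '' A) = 0} ≤
      2 - min (dimH A) (1 + ENNReal.ofReal δ) := by
  set E := {θ ∈ sphere (0 : EuclideanSpace ℝ (Fin 2)) 1 |
    volume ((fun x => ⟪θ, x⟫) '' A) = 0}
  suffices hsub : {v ∈ sphere (0 : EuclideanSpace ℝ (Fin 2)) 1 |
      (μH[1] : Measure (EuclideanSpace ℝ (Fin 2))) (P v '' A) = 0} ⊆ NormProjection.normal N '' E by
    calc _ ≤ dimH (NormProjection.normal N '' E) := dimH_mono hsub
      _ ≤ dimH E := NormProjection.dimH_image_normal_le hN_add hN_smul hN_zero hN_C2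
          fun θ hθ => hθ.1
      _ ≤ 2 - dimH A := GaussianEnergy.dimH_volume_image_inner_eq_zero_le hA hdimA
      _ ≤ _ := tsub_le_tsub_left (min_le_left _ _) _
  rintro v ⟨hvS, hv0⟩
  have hv := mem_sphere_zero_iff_norm.1 hvS
  have hmin : ∀ x, NormProjection.IsMinPerp N v (x - P v x) := fun x h hh => by
    have := (hP v hvS x).2 (P v x - h) (by rw [inner_sub_right, (hP v hvS x).1, hh, sub_zero])
    rwa [show x - (P v x - h) = x - P v x + h by abel] at this
  have hinner : ∀ x, ⟪v, x - P v x⟫ = ⟪v, x⟫ := fun x => by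
    rw [inner_sub_right, (hP v hvS x).1, sub_zero]
  set w := v - P v v
  have hvw : ⟪v, w⟫ = 1 := by rw [hinner, real_inner_self_eq_norm_sq, hv, one_pow]
  have hspan : ∀ x, x - P v x = ⟪v, x⟫ • w := fun x => by
    by_cases hx : ⟪v, x⟫ = 0
    · rw [hx, zero_smul]
      by_contra hne
      have h1 := (hP v hvS x).2 x hx
      rw [sub_self, NormProjection.map_zero_of_smul hN_smul] at h1
      exact absurd (NormProjection.pos_of_ne_zero hN_add hN_smul hN_zero hne) (not_lt.2 h1)
    · refine (hmin x).eq_of_inner_eq hN_add hN_smul hN_zero hγ_C2 hγ_range hγ_unit hγ_curv hv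
        ((hmin v).smul hN_smul hx) (by rwa [hinner]) ?_
      rw [hinner, inner_smul_right, hvw, mul_one]
  have hw0 : w ≠ 0 := fun h => by
    rw [h, inner_zero_right] at hvw
    exact zero_ne_one hvw
  have hnw : 0 < ‖w‖ := norm_pos_iff.2 hw0
  set u := ‖w‖⁻¹ • w
  have hu : ‖u‖ = 1 := by rw [norm_smul, norm_inv, norm_norm, inv_mul_cancel₀ hnw.ne']
  have hu0 : u ≠ 0 := norm_ne_zero_iff.1 (by rw [hu]; exact one_ne_zero)
  have hθ : ‖EuclideanPlane.rot u‖ = 1 := by rw [EuclideanPlane.norm_rot, hu]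
  refine ⟨EuclideanPlane.rot u, ⟨mem_sphere_zero_iff_norm.2 hθ, ?_⟩, ?_⟩
  · refine NormProjection.volume_image_inner_eq_zero hθ (fun x => ?_) hv0
    have h1 : ⟪EuclideanPlane.rot u, x - P v x⟫ = 0 := by
      rw [hspan, show w = ‖w‖ • u by rw [smul_inv_smul₀ hnw.ne'], inner_smul_right,
        inner_smul_right, EuclideanPlane.inner_rot_self, mul_zero, mul_zero]
    rw [inner_sub_right] at h1
    linarith
  · have hdiff : DifferentiableAt ℝ N u :=
      (hN_C2.contDiffAt (isOpen_compl_singleton.mem_nhds hu0)).differentiableAt (by norm_num)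
    rw [NormProjection.normal, EuclideanPlane.rot_rot, neg_neg]
    refine (((hmin v).smul hN_smul (inv_ne_zero hnw.ne')).eq_grad hN_smul hv hdiff ?_
      (NormProjection.pos_of_ne_zero hN_add hN_smul hN_zero hu0)).2.symm
    rw [inner_smul_right, hvw, mul_one]
    exact inv_pos.2 hnw
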